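/- arXiv:1308.3831 — 3 statements merged into one kernel-verified Lean document; each statement's English description precedes it below -/
import Mathlib

section
/- Let p_c^+(WH(r)) be the critical probability of the strict majority bootstrap percolation process on the family of r-wheels (WH_n(r))_n. Then the limit as r → ∞ of p_c^+(WH(r)) exists and equals 1/4. -/
open Finset


/-- Number of active neighbors of vertex `i` in the ring `C_n(r)`.
For `n > 2r+1` the `2r` offsets `±1, …, ±r` give pairwise distinct neighbors. -/
def activeNbrs (n r : ℕ) (σ : ZMod n → Bool) (i : ZMod n) : ℕ :=
  ∑ k ∈ Finset.Icc 1 r,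
    ((if σ (i + (k : ZMod n)) then 1 else 0) + (if σ (i - (k : ZMod n)) then 1 else 0))

/-- One synchronous step of strict majority bootstrap percolation on `C_n(r)`:
a passive vertex (degree `2r`) becomes active iff at least `r+1 = ⌈(2r+1)/2⌉`
of its neighbors are active; active vertices stay active. -/
def ringStep (n r : ℕ) (σ : ZMod n → Bool) : ZMod n → Bool :=
  fun i => σ i || decide (r + 1 ≤ activeNbrs n r σ i)

/-- The fixed point of strict MBP on `C_n(r)`; `n` monotone steps suffice to stabilize. -/
def ringFix (n r : ℕ) (σ : ZMod n → Bool) : ZMod n → Bool :=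
  (ringStep n r)^[n] σ

/-- Probability of an event under i.i.d. Bernoulli(`p`) initial states. -/
noncomputable def pr {V : Type} [Fintype V] [DecidableEq V] (p : ℝ) (S : Set (V → Bool)) : ℝ :=
  ∑ σ : V → Bool, S.indicator (fun τ => ∏ v, (if τ v then p else 1 - p)) σ

/-- Expectation of a random variable under i.i.d. Bernoulli(`p`) initial states. -/
noncomputable def expec {V : Type} [Fintype V] [DecidableEq V]
    (p : ℝ) (f : (V → Bool) → ℝ) : ℝ :=
  ∑ σ : V → Bool, f σ * ∏ v, (if σ v then p else 1 - p)

/-- `E_p[X_0(n,r)]`: probability that vertex `0` is active at the fixed point. -/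
noncomputable def Ex (r : ℕ) (p : ℝ) (n : ℕ) : ℝ :=
  if h : n = 0 then 0 else
    haveI : NeZero n := ⟨h⟩
    pr p {σ : ZMod n → Bool | ringFix n r σ 0 = true}

/-- `p_R(n,r,p)`: probability that strictly more than half of the `n` vertices are
active at the fixed point of strict MBP on `C_n(r)`. -/
noncomputable def pR (r : ℕ) (p : ℝ) (n : ℕ) : ℝ :=
  if h : n = 0 then 0 else
    haveI : NeZero n := ⟨h⟩
    pr p {σ : ZMod n → Bool |
      n < 2 * (Finset.univ.filter (fun i : ZMod n => ringFix n r σ i = true)).card}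

open Finset

/-- Number of active neighbors of ring vertex `i` in the `r`-wheel `WH_n(r)`:
its `2r` ring neighbors plus the universal vertex (`none`). -/
def wheelNbrs (n r : ℕ) (σ : Option (ZMod n) → Bool) (i : ZMod n) : ℕ :=
  (if σ none then 1 else 0) +
    ∑ k ∈ Finset.Icc 1 r,
      ((if σ (some (i + (k : ZMod n))) then 1 else 0) +
       (if σ (some (i - (k : ZMod n))) then 1 else 0))

/-- One synchronous step of strict MBP on the `r`-wheel `WH_n(r)`. The universal
vertex (degree `n`) needs at least `⌈(n+1)/2⌉` active neighbors (i.e. `n+1 ≤ 2·#active`);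
a ring vertex (degree `2r+1`) needs at least `r+1 = ⌈(2r+2)/2⌉` active neighbors. -/
def wheelStep (n r : ℕ) [NeZero n] (σ : Option (ZMod n) → Bool) :
    Option (ZMod n) → Bool :=
  fun v =>
    match v with
    | none => σ none ||
        decide (n + 1 ≤ 2 * (Finset.univ.filter (fun i : ZMod n => σ (some i) = true)).card)
    | some i => σ (some i) || decide (r + 1 ≤ wheelNbrs n r σ i)

/-- The fixed point of strict MBP on `WH_n(r)`; `n+1` monotone steps suffice. -/
def wheelFix (n r : ℕ) [NeZero n] (σ : Option (ZMod n) → Bool) : Option (ZMod n) → Bool :=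
  (wheelStep n r)^[n + 1] σ

/-- `p_W(n,r,p)`: probability that strict MBP on the `r`-wheel `WH_n(r)` percolates. -/
noncomputable def pW (r : ℕ) (p : ℝ) (n : ℕ) : ℝ :=
  if h : n = 0 then 0 else
    haveI : NeZero n := ⟨h⟩
    pr p {σ : Option (ZMod n) → Bool | ∀ v, wheelFix n r σ v = true}

/-- `p_c^+(WH(r)) = inf{ p ∈ [0,1] : liminf_{n→∞} P_p(A percolates WH_n(r)) = 1 }`. -/
noncomputable def pcPlus (r : ℕ) : ℝ :=
  sInf {p : ℝ | p ∈ Set.Icc (0:ℝ) 1 ∧ Filter.liminf (fun n => pW r p n) Filter.atTop = 1}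


namespace WH
open MeasureTheory ProbabilityTheory

noncomputable def bern (p : ℝ) : Measure Bool :=
  ENNReal.ofReal p • Measure.dirac true + ENNReal.ofReal (1 - p) • Measure.dirac false

instance bern_prob (p : ℝ) [hp : Fact (p ∈ Set.Icc (0:ℝ) 1)] : IsProbabilityMeasure (bern p) := by
  constructor
  have h := hp.out
  simp only [bern, Measure.coe_add, Measure.coe_smul, Pi.add_apply, Pi.smul_apply, measure_univ,
    smul_eq_mul, mul_one]
  rw [← ENNReal.ofReal_add h.1 (by linarith [h.2])]
  simp

noncomputable def PM (V : Type) [Fintype V] (p : ℝ) : Measure (V → Bool) :=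
  Measure.pi (fun _ : V => bern p)

instance PM_prob (V : Type) [Fintype V] (p : ℝ) [hp : Fact (p ∈ Set.Icc (0:ℝ) 1)] :
    IsProbabilityMeasure (PM V p) := by
  unfold PM; infer_instance

lemma meas {V : Type} [Fintype V] (S : Set (V → Bool)) : MeasurableSet S :=
  S.toFinite.measurableSet

lemma mono {V : Type} [Fintype V] (p : ℝ) [hp : Fact (p ∈ Set.Icc (0:ℝ) 1)]
    {A B : Set (V → Bool)} (h : A ⊆ B) : (PM V p).real A ≤ (PM V p).real B :=
  measureReal_mono h (measure_ne_top _ _)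

lemma bern_real (p : ℝ) [hp : Fact (p ∈ Set.Icc (0:ℝ) 1)] (b : Bool) :
    (bern p).real {b} = if b then p else 1 - p := by
  have h := hp.out
  have h2 : 0 ≤ 1 - p := by linarith [h.2]
  cases b <;> simp [bern, measureReal_def, h.1, h2]

lemma pat {V : Type} [Fintype V] [DecidableEq V] (p : ℝ) [hp : Fact (p ∈ Set.Icc (0:ℝ) 1)]
    (B : Finset V) (s : V → Bool) :
    (PM V p).real {σ | ∀ v ∈ B, σ v = s v} = ∏ v ∈ B, (if s v then p else 1 - p) := by
  have : {σ : V → Bool | ∀ v ∈ B, σ v = s v}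
      = Set.pi Set.univ (fun v => if v ∈ B then ({s v} : Set Bool) else Set.univ) := by
    ext σ
    simp only [Set.mem_ofPred_eq, Set.mem_pi, Set.mem_univ, true_imp_iff]
    refine forall_congr' fun v => ?_
    by_cases hv : v ∈ B <;> simp [hv]
  rw [this, measureReal_def, PM, Measure.pi_pi, ENNReal.toReal_prod]
  rw [← Finset.prod_subset (Finset.subset_univ B)]
  · refine Finset.prod_congr rfl fun v hv => ?_
    rw [if_pos hv, ← bern_real]; rfl
  · intro v _ hv
    rw [if_neg hv, measure_univ, ENNReal.toReal_one]

lemma pr_eq {V : Type} [Fintype V] [DecidableEq V] (p : ℝ) [hp : Fact (p ∈ Set.Icc (0:ℝ) 1)]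
    (S : Set (V → Bool)) : pr p S = (PM V p).real S := by
  classical
  unfold pr
  have h1 : ∀ σ : V → Bool, (∏ v, (if σ v then p else 1 - p)) = (PM V p).real {σ} := by
    intro σ
    rw [← pat]
    congr 1
    ext τ
    simp [funext_iff]
  simp_rw [Set.indicator_apply, h1]
  rw [← Finset.sum_filter]
  rw [sum_measureReal_singleton]
  congr 1
  ext σ; simp

/-- `A` depends only on the coordinates in `B`. -/
def Dep {V : Type} (B : Finset V) (A : Set (V → Bool)) : Prop :=
  ∀ σ τ : V → Bool, (∀ v ∈ B, σ v = τ v) → σ ∈ A → τ ∈ A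

lemma Dep.compl {V : Type} {B : Finset V} {A : Set (V → Bool)} (h : Dep B A) : Dep B Aᶜ :=
  fun σ τ hst hs ht => hs (h τ σ (fun v hv => (hst v hv).symm) ht)

lemma indep2 {V : Type} [Fintype V] [DecidableEq V] (p : ℝ) [hp : Fact (p ∈ Set.Icc (0:ℝ) 1)]
    {B C : Finset V} (hd : Disjoint B C) {A D : Set (V → Bool)} (hA : Dep B A) (hD : Dep C D) :
    (PM V p).real (A ∩ D) = (PM V p).real A * (PM V p).real D := by
  have h0 : iIndepFun (fun (v : V) (σ : V → Bool) => σ v) (PM V p) := by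
    have := iIndepFun_pi (μ := fun _ : V => bern p) (X := fun _ => (id : Bool → Bool))
      (fun _ => aemeasurable_id)
    exact this
  have h1 := h0.indepFun_finset B C hd (fun v => measurable_pi_apply v)
  have key : ∀ (B : Finset V) (A : Set (V → Bool)), Dep B A →
      A = (fun (σ : V → Bool) (v : B) => σ v) ⁻¹' ((fun (σ : V → Bool) (v : B) => σ v) '' A) := by
    intro B A hA
    ext σ
    constructor
    · exact fun h => ⟨σ, h, rfl⟩
    · rintro ⟨τ, ht, he⟩
      exact hA τ σ (fun v hv => congrFun he ⟨v, hv⟩) ht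
  have h2 := h1.measure_inter_preimage_eq_mul
    ((fun (σ : V → Bool) (v : B) => σ v) '' A) ((fun (σ : V → Bool) (v : C) => σ v) '' D)
    (meas _) (meas _)
  rw [← key B A hA, ← key C D hD] at h2
  simp [measureReal_def, h2]

lemma indep {V ι : Type} [Fintype V] [DecidableEq V] [DecidableEq ι] (p : ℝ)
    [hp : Fact (p ∈ Set.Icc (0:ℝ) 1)] (J : Finset ι) (B : ι → Finset V) (A : ι → Set (V → Bool))
    (hB : ∀ i ∈ J, ∀ j ∈ J, i ≠ j → Disjoint (B i) (B j)) (hA : ∀ j ∈ J, Dep (B j) (A j)) :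
    (PM V p).real {σ | ∀ j ∈ J, σ ∈ A j} = ∏ j ∈ J, (PM V p).real (A j) := by
  induction J using Finset.induction_on with
  | empty => simp
  | insert a J ha ih =>
    rw [Finset.prod_insert ha, ← ih (fun i hi j hj => hB i (by simp [hi]) j (by simp [hj]))
      (fun j hj => hA j (by simp [hj])), ← indep2 p (B := B a) (C := J.biUnion B)]
    · congr 1
      ext σ; simp
    · rw [Finset.disjoint_biUnion_right]
      intro i hi
      exact hB a (by simp) i (by simp [hi]) (by rintro rfl; exact ha hi)
    · exact hA a (by simp)
    · intro σ τ hst hs j hj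
      exact hA j (by simp [hj]) σ τ (fun v hv => hst v (by simp; exact ⟨j, hj, hv⟩)) (hs j hj)

/-- probability that all coordinates of `B` have value `b`. -/
lemma allval {V : Type} [Fintype V] [DecidableEq V] (p : ℝ) [hp : Fact (p ∈ Set.Icc (0:ℝ) 1)]
    (B : Finset V) (b : Bool) :
    (PM V p).real {σ | ∀ v ∈ B, σ v = b} = (if b then p else 1 - p) ^ B.card := by
  rw [pat p B (fun _ => b)]; simp

lemma pat_subset {V : Type} [Fintype V] [DecidableEq V] (p : ℝ)
    [hp : Fact (p ∈ Set.Icc (0:ℝ) 1)] (B S : Finset V) (hS : S ⊆ B) :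
    (PM V p).real {σ | B.filter (fun v => σ v = true) = S}
      = p ^ S.card * (1 - p) ^ (B.card - S.card) := by
  have : {σ : V → Bool | B.filter (fun v => σ v = true) = S}
      = {σ | ∀ v ∈ B, σ v = decide (v ∈ S)} := by
    ext σ
    simp only [Set.mem_ofPred_eq, Finset.ext_iff, Finset.mem_filter]
    constructor
    · intro h v hv
      have := h v
      by_cases h2 : v ∈ S
      · simpa [h2, hv] using this
      · simpa [h2, hv] using this
    · intro h v
      by_cases hv : v ∈ B
      · simp [hv, h v hv]
      · have : v ∉ S := fun h => hv (hS h)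
        simp [hv, this]
  rw [this, pat]
  simp only [decide_eq_true_eq]
  rw [Finset.prod_ite]
  simp only [Finset.prod_const]
  rw [Finset.filter_mem_eq_inter, Finset.inter_eq_right.2 hS, Finset.filter_not,
    Finset.filter_mem_eq_inter, Finset.inter_eq_right.2 hS, Finset.card_sdiff_of_subset hS]

/-- upper tail: at least half. -/
lemma tail_le {V : Type} [Fintype V] [DecidableEq V] (p p0 : ℝ)
    [hp : Fact (p ∈ Set.Icc (0:ℝ) 1)] (hpp : p ≤ p0) (hp0 : p0 ≤ 1/2) (r : ℕ) (B : Finset V)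
    (hB : B.card = 2 * r) :
    (PM V p).real {σ | r ≤ (B.filter (fun v => σ v = true)).card} ≤ (4 * p0 * (1 - p0)) ^ r := by
  have h := hp.out
  have hsub : {σ : V → Bool | r ≤ (B.filter (fun v => σ v = true)).card}
      ⊆ ⋃ S ∈ B.powerset.filter (fun S => r ≤ S.card), {σ | B.filter (fun v => σ v = true) = S} := by
    intro σ hσ
    simp only [Set.mem_iUnion, Set.mem_ofPred_eq]
    exact ⟨_, by simp; exact hσ, rfl⟩
  have hpq : p * (1 - p) ≤ p0 * (1 - p0) := by nlinarith [h.1]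
  have hpq0 : 0 ≤ p * (1 - p) := mul_nonneg h.1 (by linarith [h.2])
  refine (mono p hsub).trans ((measureReal_biUnion_finset_le _ _).trans ?_)
  calc _ ≤ ∑ S ∈ B.powerset.filter (fun S => r ≤ S.card), (p0 * (1 - p0)) ^ r := by
        refine Finset.sum_le_sum fun S hS => ?_
        simp only [Finset.mem_filter, Finset.mem_powerset] at hS
        rw [pat_subset p B S hS.1, hB]
        have hc : S.card ≤ 2 * r := hB ▸ Finset.card_le_card hS.1
        obtain ⟨d, hd⟩ := Nat.exists_eq_add_of_le hS.2
        obtain ⟨f, hf⟩ := Nat.exists_eq_add_of_le (show d ≤ r by omega)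
        have : 2 * r - S.card = f := by omega
        rw [this, hd]
        calc p ^ (r + d) * (1 - p) ^ f = p ^ r * (p ^ d * (1 - p) ^ f) := by ring
          _ ≤ p ^ r * ((1 - p) ^ d * (1 - p) ^ f) := by
            have : (0:ℝ) ≤ 1 - p := by linarith [h.2]
            have h0 := h.1
            gcongr
            linarith
          _ = (p * (1 - p)) ^ r := by rw [← pow_add, ← hf, mul_pow]
          _ ≤ _ := pow_le_pow_left₀ hpq0 hpq r
    _ ≤ ∑ S ∈ B.powerset, (p0 * (1 - p0)) ^ r := by
        refine Finset.sum_le_sum_of_subset_of_nonneg (Finset.filter_subset _ _) ?_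
        intros; exact pow_nonneg (hpq0.trans hpq) _
    _ = _ := by
        rw [Finset.sum_const, Finset.card_powerset, hB, nsmul_eq_mul, pow_mul]
        push_cast
        rw [← mul_pow]; congr 1; ring

/-- lower bound: at least half. -/
lemma half_ge {V : Type} [Fintype V] [DecidableEq V] (p : ℝ)
    [hp : Fact (p ∈ Set.Icc (0:ℝ) 1)] (m : ℕ) (hm : 0 < m) (B : Finset V)
    (hB : B.card = 2 * m) :
    (4 * p * (1 - p)) ^ m / (2 * m) ≤
      (PM V p).real {σ | m ≤ (B.filter (fun v => σ v = true)).card} := by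
  have h := hp.out
  have hsub : (⋃ S ∈ B.powersetCard m, {σ : V → Bool | B.filter (fun v => σ v = true) = S})
      ⊆ {σ : V → Bool | m ≤ (B.filter (fun v => σ v = true)).card} := by
    intro σ hσ
    simp only [Set.mem_iUnion, Set.mem_ofPred_eq] at hσ ⊢
    obtain ⟨S, hS, hσ⟩ := hσ
    rw [hσ]; exact (Finset.mem_powersetCard.1 hS).2.ge
  refine le_trans ?_ (mono p hsub)
  rw [measureReal_biUnion_finset]
  · have hpq0 : 0 ≤ p * (1 - p) := mul_nonneg h.1 (by linarith [h.2])
    have : ∀ S ∈ B.powersetCard m,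
        (PM V p).real {σ : V → Bool | B.filter (fun v => σ v = true) = S} = (p * (1 - p)) ^ m := by
      intro S hS
      rw [Finset.mem_powersetCard] at hS
      rw [pat_subset p B S hS.1, hB, hS.2, mul_pow]
      congr 2; omega
    rw [Finset.sum_congr rfl this, Finset.sum_const, Finset.card_powersetCard, hB, nsmul_eq_mul]
    have h4 := Nat.four_pow_le_two_mul_self_mul_centralBinom m hm
    rw [Nat.centralBinom_eq_two_mul_choose] at h4
    have h5 : (4:ℝ) ^ m ≤ 2 * m * ((2 * m).choose m : ℝ) := by exact_mod_cast h4
    have hm' : (0:ℝ) < 2 * m := by positivity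
    rw [div_le_iff₀ hm', mul_assoc, mul_pow]
    calc _ ≤ (2 * m * ((2 * m).choose m : ℝ)) * (p * (1 - p)) ^ m := by gcongr
      _ = _ := by ring
  · intro S _ T _ hST
    refine Set.disjoint_left.2 fun σ h1 h2 => hST ?_
    exact h1.symm.trans h2
  · intro S _; exact meas _

end WH

namespace WH

/-- number of active sites of `t` in `[a, b)`. -/
noncomputable def N (t : ℤ → Bool) (a b : ℤ) : ℕ := ((Finset.Ico a b).filter (fun i => t i = true)).card

lemma N_add (t : ℤ → Bool) {a b c : ℤ} (h1 : a ≤ b) (h2 : b ≤ c) :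
    N t a b + N t b c = N t a c := by
  unfold N
  rw [← Finset.Ico_union_Ico_eq_Ico h1 h2, Finset.filter_union, Finset.card_union_of_disjoint]
  exact Finset.disjoint_filter_filter (Finset.Ico_disjoint_Ico_consecutive a b c)

lemma N_mono (t : ℤ → Bool) {a b c d : ℤ} (h1 : c ≤ a) (h2 : b ≤ d) : N t a b ≤ N t c d :=
  Finset.card_le_card (Finset.filter_subset_filter _ (Finset.Ico_subset_Ico h1 h2))

lemma N_full (t : ℤ → Bool) {a b : ℤ} (h : ∀ i, a ≤ i → i < b → t i = true) :
    N t a b = (b - a).toNat := by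
  unfold N
  rw [Finset.filter_true_of_mem, Int.card_Ico]
  intro i hi
  rw [Finset.mem_Ico] at hi
  exact h i hi.1 hi.2

lemma N_mono_t {s t : ℤ → Bool} (h : ∀ i, s i = true → t i = true) (a b : ℤ) :
    N s a b ≤ N t a b :=
  Finset.card_le_card (Finset.monotone_filter_right _ (fun i _ => h i))

lemma sum_right (t : ℤ → Bool) (r : ℕ) (i : ℤ) :
    ∑ k ∈ Finset.Icc 1 r, (if t (i + (k : ℤ)) then 1 else 0) = N t (i + 1) (i + r + 1) := by
  unfold N
  rw [Finset.card_filter]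
  refine Finset.sum_nbij' (fun k : ℕ => i + (k : ℤ)) (fun z => (z - i).toNat) ?_ ?_ ?_ ?_ ?_
  · intro k hk; simp at hk ⊢; omega
  · intro k hk; simp at hk ⊢; omega
  · intro k hk; simp
  · intro k hk; simp at hk ⊢; omega
  · intro k hk; rfl

lemma sum_left (t : ℤ → Bool) (r : ℕ) (i : ℤ) :
    ∑ k ∈ Finset.Icc 1 r, (if t (i - (k : ℤ)) then 1 else 0) = N t (i - r) i := by
  unfold N
  rw [Finset.card_filter]
  refine Finset.sum_nbij' (fun k : ℕ => i - (k : ℤ)) (fun z => (i - z).toNat) ?_ ?_ ?_ ?_ ?_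
  · intro k hk; simp at hk ⊢; omega
  · intro k hk; simp at hk ⊢; omega
  · intro k hk; simp
  · intro k hk; simp at hk ⊢; omega
  · intro k hk; rfl

/-- `t` is closed under the dynamics, with `e` extra active neighbors. -/
def Closed (e r : ℕ) (t : ℤ → Bool) : Prop :=
  ∀ i, t i = false → e + N t (i + 1) (i + r + 1) + N t (i - r) i ≤ r

def Sub (m l : ℕ) (c : ℤ) (j : ℕ) (t : ℤ → Bool) : Prop :=
  if l ≤ j + 5 ∧ j < l then ∀ i, c + 2 * m * j ≤ i → i < c + 2 * m * j + 2 * m → t i = true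
  else m ≤ N t (c + 2 * m * j) (c + 2 * m * j + 2 * m)

def Nuc (m l : ℕ) (c : ℤ) (t : ℤ → Bool) : Prop := ∀ j < 2 * l, Sub m l c j t

lemma Nuc.mono {m l : ℕ} {c : ℤ} {s t : ℤ → Bool} (h : ∀ i, s i = true → t i = true)
    (hs : Nuc m l c s) : Nuc m l c t := by
  intro j hj
  have := hs j hj
  unfold Sub at this ⊢
  split_ifs at this ⊢ with h1
  · exact fun i h2 h3 => h i (this i h2 h3)
  · exact this.trans (N_mono_t h _ _)

lemma Nuc.sub {m l : ℕ} {c : ℤ} {t : ℤ → Bool} (h : Nuc m l c t) {j : ℕ} (hj : j < 2 * l) :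
    m ≤ N t (c + 2 * m * j) (c + 2 * m * j + 2 * m) := by
  have := h j hj
  unfold Sub at this
  split_ifs at this with h1
  · rw [N_full t this]; omega
  · exact this

lemma Nuc.blocks {m l : ℕ} {c : ℤ} {t : ℤ → Bool} (h : Nuc m l c t) (J d : ℕ)
    (hJ : J + d ≤ 2 * l) :
    m * d ≤ N t (c + 2 * m * J) (c + 2 * m * (J + d : ℕ)) := by
  induction d with
  | zero => simp
  | succ d ih =>
    have h1 := ih (by omega)
    have h2 := h.sub (j := J + d) (by omega)
    rw [← N_add t (b := c + 2 * m * (J + d : ℕ))]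
    · have : c + 2 * (m:ℤ) * (J + (d + 1) : ℕ) = c + 2 * m * (J + d : ℕ) + 2 * m := by
        push_cast; ring
      rw [this]
      rw [mul_add, mul_one]
      exact add_le_add h1 h2
    · push_cast; nlinarith
    · push_cast; nlinarith

lemma Nuc.walk {m l : ℕ} {c : ℤ} {t : ℤ → Bool} (hm : 0 < m) (h : Nuc m l c t) (a b : ℕ)
    (hab : a ≤ b) (hb : b ≤ 4 * m * l) :
    b ≤ 2 * N t (c + a) (c + b) + a + 4 * m := by
  have hb1 := Nat.div_add_mod b (2 * m)
  have hb2 := Nat.mod_lt b (show 0 < 2 * m by omega)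
  have ha1 := Nat.div_add_mod a (2 * m)
  have ha2 := Nat.mod_lt a (show 0 < 2 * m by omega)
  set A := a / (2 * m)
  set B := b / (2 * m)
  by_cases hAB : A + 1 ≤ B
  · obtain ⟨d, hd⟩ := Nat.exists_eq_add_of_le hAB
    have hB : B ≤ 2 * l := by
      by_contra hcon
      have : 2 * m * (2 * l + 1) ≤ 2 * m * B := Nat.mul_le_mul_left _ (by omega)
      have e : 2 * m * (2 * l + 1) = 4 * m * l + 2 * m := by ring
      omega
    have h1 := h.blocks (A + 1) d (by omega)
    have h2 : N t (c + 2 * m * (A + 1 : ℕ)) (c + 2 * m * (A + 1 + d : ℕ))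
        ≤ N t (c + a) (c + b) := by
      apply N_mono
      · have : (a:ℤ) ≤ 2 * m * (A + 1 : ℕ) := by
          have : a ≤ 2 * m * (A + 1) := by rw [mul_add]; omega
          exact_mod_cast this
        linarith
      · have : (2 * m * (A + 1 + d : ℕ) : ℤ) ≤ b := by
          have : 2 * m * (A + 1 + d) ≤ b := by rw [← hd]; omega
          exact_mod_cast this
        linarith
    have h3 : 2 * m * B = 2 * m * A + 2 * m + 2 * (m * d) := by rw [hd]; ring
    omega
  · have : 2 * m * B ≤ 2 * m * A := Nat.mul_le_mul_left _ (by omega)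
    omega

lemma Nuc.grow {m l r : ℕ} {c : ℤ} {t : ℤ → Bool} (hm : 0 < m) (hr : 10 * m ≤ r)
    (hl : r < 2 * m * l) (hc : Closed 0 r t) (h : Nuc m l c t) (d : ℕ) (hd : d < r) :
    t (c + 2 * m * l - 10 * m + d) = true := by
  have hl5 : 5 ≤ l := by
    by_contra hcon
    have : 2 * m * l ≤ 2 * m * 4 := Nat.mul_le_mul_left _ (by omega)
    omega
  have hz : ((2 * m * l : ℕ) : ℤ) = 2 * m * l := by push_cast; rfl
  induction d using Nat.strong_induction_on with
  | _ d ih =>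
  by_cases hd10 : d < 10 * m
  · have hb1 := Nat.div_add_mod d (2 * m)
    have hb2 := Nat.mod_lt d (show 0 < 2 * m by omega)
    generalize d / (2 * m) = D at *
    generalize d % (2 * m) = Dm at *
    have hD : D < 5 := by
      by_contra hcon
      have : 2 * m * 5 ≤ 2 * m * D := Nat.mul_le_mul_left _ (by omega)
      omega
    have h1 := h (l - 5 + D) (by omega)
    unfold Sub at h1
    rw [if_pos (by omega)] at h1
    have h2 : (2 * m * (l - 5 + D : ℕ) : ℤ) = 2 * m * l - 10 * m + (2 * m * D : ℕ) := by
      push_cast [hl5]; ring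
    apply h1
    · rw [h2]; omega
    · rw [h2]; omega
  · by_contra hcon
    have hcl := hc _ (by simpa using hcon)
    rw [← N_add t (a := c + 2 * m * l - 10 * m + d - r) (b := c + 2 * m * l - 10 * m)
      (c := c + 2 * m * l - 10 * m + d) (by omega) (by omega),
      N_full t (a := c + 2 * m * l - 10 * m) (b := c + 2 * m * l - 10 * m + d)] at hcl
    · have w1 := h.walk hm (2 * m * l - 10 * m + d - r) (2 * m * l - 10 * m) (by omega) (by
        have : 4 * m * l = 2 * m * l + 2 * m * l := by ring
        omega)
      have w2 := h.walk hm (2 * m * l - 10 * m + d + 1) (2 * m * l + r) (by omega) (by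
        have : 4 * m * l = 2 * m * l + 2 * m * l := by ring
        omega)
      have e1 : c + ((2 * m * l - 10 * m + d - r : ℕ) : ℤ) = c + 2 * m * l - 10 * m + d - r := by
        omega
      have e2 : c + ((2 * m * l - 10 * m : ℕ) : ℤ) = c + 2 * m * l - 10 * m := by
        omega
      have e3 : c + ((2 * m * l - 10 * m + d + 1 : ℕ) : ℤ) = c + 2 * m * l - 10 * m + d + 1 := by
        omega
      have w3 : N t (c + ((2 * m * l - 10 * m + d + 1 : ℕ) : ℤ)) (c + ((2 * m * l + r : ℕ) : ℤ))
         ≤ N t (c + 2 * m * l - 10 * m + d + 1) (c + 2 * m * l - 10 * m + d + r + 1) := by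
        apply N_mono <;> omega
      rw [e1, e2] at w1
      omega
    · intro i h1 h2
      have := ih (i - (c + 2 * m * l - 10 * m)).toNat (by omega) (by omega)
      rw [← this]; congr 1; omega

/-- spreading to the right, in the absence of long passive runs. -/
lemma spread {r : ℕ} {t : ℤ → Bool} (hc : Closed 0 r t) {x E : ℤ}
    (hx : ∀ i, x ≤ i → i < x + r → t i = true)
    (hrun : ∀ i, x ≤ i → i + r < E → ∃ j : ℤ, i ≤ j ∧ j ≤ i + r ∧ t j = true)
    (d : ℕ) (hd : x + d + r < E) : t (x + d) = true := by
  induction d using Nat.strong_induction_on with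
  | _ d ih =>
  by_cases hdr : d < r
  · exact hx _ (by omega) (by omega)
  by_contra hcon
  have hcl := hc _ (by simpa using hcon)
  rw [N_full t (a := x + d - r)] at hcl
  · obtain ⟨j, h1, h2, h3⟩ := hrun (x + d) (by omega) hd
    have hne : j ≠ x + d := by rintro rfl; exact hcon h3
    have h4 : N t j (j + 1) ≤ N t (x + d + 1) (x + d + r + 1) := N_mono t (by omega) (by omega)
    rw [N_full t (a := j)] at h4
    · omega
    · intro i h5 h6
      have : i = j := by omega
      rw [this]; exact h3
  · intro i h1 h2
    have := ih (i - x).toNat (by omega) (by omega)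
    rw [← this]; congr 1; omega

lemma spread1 {r : ℕ} {t : ℤ → Bool} (hc : Closed 1 r t) {x : ℤ}
    (hx : ∀ i, x ≤ i → i < x + r → t i = true)
    (d : ℕ) : t (x + d) = true := by
  induction d using Nat.strong_induction_on with
  | _ d ih =>
  by_cases hdr : d < r
  · exact hx _ (by omega) (by omega)
  by_contra hcon
  have hcl := hc _ (by simpa using hcon)
  rw [N_full t (a := x + d - r)] at hcl
  · omega
  · intro i h1 h2
    have := ih (i - x).toNat (by omega)
    rw [← this]; congr 1; omega

/-- good segment `[S, S + M)` with `M = 16 H K`, `H = 2 m l`. -/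
def Good (m l r K : ℕ) (S : ℤ) (t : ℤ → Bool) : Prop :=
  (∃ k < K, Nuc m l (S + 4 * m * l * k) t) ∧
  (∀ i : ℕ, i + r < 32 * m * l * K → ∃ j : ℕ, j ≤ r ∧ t (S + i + j) = true)

lemma Good.active {m l r K : ℕ} {S : ℤ} {s t : ℤ → Bool} (hm : 0 < m) (hr : 10 * m ≤ r)
    (hl : r < 2 * m * l) (hc : Closed 0 r t) (hst : ∀ i, s i = true → t i = true)
    (h : Good m l r K S s) (d : ℕ) (hd : d < 24 * m * l * K) :
    t (S + 4 * m * l * K + d) = true := by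
  obtain ⟨⟨k, hk, hn⟩, hrun⟩ := h
  have hn' := Nuc.mono hst hn
  have hb := fun d hd => hn'.grow hm hr hl hc d hd
  have hz : ((2 * m * l : ℕ) : ℤ) = 2 * m * l := by push_cast; rfl
  obtain ⟨q, rfl⟩ := Nat.exists_eq_add_of_lt hk
  set x : ℤ := S + 4 * m * l * k + 2 * m * l - 10 * m with hxdef
  have hx : ∀ i, x ≤ i → i < x + r → t i = true := by
    intro i h1 h2
    have := hb (i - x).toNat (by omega)
    rw [← this]; congr 1; omega
  have hS : S ≤ x := by
    have : (0:ℤ) ≤ 4 * m * l * k := by positivity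
    omega
  have e1 : 4 * (m:ℤ) * l * (k + q + 1 : ℕ) = 4 * m * l * k + 4 * m * l * q + 4 * m * l := by
    push_cast; ring
  have e2 : (24 * m * l * (k + q + 1) : ℕ) = 6 * (4 * m * l * (k+q+1)) := by ring
  have e3 : (32 * m * l * (k + q + 1) : ℕ) = 8 * (4 * m * l * (k+q+1)) := by ring
  have e4 : 4 * m * l * (k + q + 1) = 4 * m * l * k + 4 * m * l * q + 2 * (2 * m * l) := by ring
  have e5 : (4:ℤ) * m * l * k = (4 * m * l * k : ℕ) := by push_cast; rfl
  have e6 : (4:ℤ) * m * l * q = (4 * m * l * q : ℕ) := by push_cast; rfl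
  have e7 : (4:ℤ) * m * l = 2 * (2 * m * l : ℕ) := by push_cast; ring
  rw [e2, e4] at hd
  have := spread hc hx (E := S + (32 * m * l * (k + q + 1) : ℕ)) (by
    intro i h1 h2
    obtain ⟨j, hj, hj2⟩ := hrun (i - S).toNat (by omega)
    refine ⟨i + j, by omega, by omega, ?_⟩
    apply hst
    rw [← hj2]; congr 1; omega) (S + 4 * m * l * (k + q + 1 : ℕ) + d - x).toNat (by
      rw [e1, e3, e4, e5, e6, e7] 
      rw [hxdef, e5] at *
      omega)
  rw [← this]; congr 1; 
  rw [e1, e5, e6, e7]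
  rw [hxdef, e5] at *
  omega

end WH

namespace WH
open MeasureTheory ProbabilityTheory

lemma cast_inj {n : ℕ} {a b : ℤ} (h : |b - a| < n) (he : (a : ZMod n) = b) : a = b := by
  rw [ZMod.intCast_eq_intCast_iff_dvd_sub] at he
  have := Int.eq_zero_of_abs_lt_dvd he h
  omega

/-- configuration of the ring lifted to the integers -/
def cfg {n : ℕ} (σ : Option (ZMod n) → Bool) : ℤ → Bool := fun z => σ (some (z : ZMod n))

noncomputable def win (n : ℕ) (a b : ℤ) : Finset (Option (ZMod n)) :=
  (Finset.Ico a b).image (fun z : ℤ => some (z : ZMod n))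

lemma win_injOn {n : ℕ} {a b : ℤ} (h : b - a ≤ n) :
    Set.InjOn (fun z : ℤ => some (z : ZMod n)) (Finset.Ico a b) := by
  intro x hx y hy hxy
  simp only [Finset.coe_Ico, Set.mem_Ico] at hx hy
  refine cast_inj (n := n) ?_ (Option.some.inj hxy)
  rw [abs_lt]; constructor <;> omega

lemma win_card {n : ℕ} {a b : ℤ} (h : b - a ≤ n) : (win n a b).card = (b - a).toNat := by
  unfold win
  rw [Finset.card_image_of_injOn (win_injOn h), Int.card_Ico]

lemma win_disj {n : ℕ} {a b c d : ℤ} (h1 : b ≤ c) (h2 : d - a ≤ n) :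
    Disjoint (win n a b) (win n c d) := by
  rw [Finset.disjoint_left]
  intro v hv hw
  simp only [win, Finset.mem_image, Finset.mem_Ico] at hv hw
  obtain ⟨x, hx, rfl⟩ := hv
  obtain ⟨y, hy, he⟩ := hw
  have := cast_inj (n := n) (a := x) (b := y) (by rw [abs_lt]; constructor <;> omega)
    (Option.some.inj he.symm)
  omega

lemma N_cfg {n : ℕ} {a b : ℤ} (h : b - a ≤ n) (σ : Option (ZMod n) → Bool) :
    N (cfg σ) a b = ((win n a b).filter (fun v => σ v = true)).card := by
  unfold win
  rw [Finset.filter_image, Finset.card_image_of_injOn]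
  · rfl
  · exact (win_injOn h).mono (by intro x; simp; tauto)

lemma dep_win {n : ℕ} {a b : ℤ} (E : (ℤ → Bool) → Prop)
    (hE : ∀ s t : ℤ → Bool, (∀ i, a ≤ i → i < b → s i = t i) → E s → E t) :
    Dep (win n a b) {σ | E (cfg σ)} := by
  intro σ τ h hs
  refine hE _ _ (fun i h1 h2 => ?_) hs
  exact h _ (Finset.mem_image.2 ⟨i, by simp [h1, h2], rfl⟩)

lemma N_congr {s t : ℤ → Bool} {a b : ℤ} (h : ∀ i, a ≤ i → i < b → s i = t i) :
    N s a b = N t a b := by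
  unfold N
  congr 1
  apply Finset.filter_congr
  intro i hi
  rw [Finset.mem_Ico] at hi
  rw [h i hi.1 hi.2]

lemma Sub.congr {m l : ℕ} {c : ℤ} {j : ℕ} {s t : ℤ → Bool}
    (h : ∀ i, c + 2 * m * j ≤ i → i < c + 2 * m * j + 2 * m → s i = t i) (hs : Sub m l c j s) :
    Sub m l c j t := by
  unfold Sub at hs ⊢
  split_ifs at hs ⊢ with h1
  · intro i h2 h3; rw [← h i h2 h3]; exact hs i h2 h3
  · rw [← N_congr h]; exact hs

noncomputable def nu (p : ℝ) (m l : ℕ) : ℝ :=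
  p ^ (10 * m) * ((4 * p * (1 - p)) ^ m / (2 * m)) ^ (2 * l)

section
variable (p : ℝ) [hp : Fact (p ∈ Set.Icc (0:ℝ) 1)]

lemma beta_mem (m : ℕ) (hm : 0 < m) :
    0 ≤ (4 * p * (1 - p)) ^ m / (2 * m) ∧ (4 * p * (1 - p)) ^ m / (2 * m) ≤ 1 := by
  have h := hp.out
  have h0 : 0 ≤ 4 * p * (1 - p) := mul_nonneg (by linarith [h.1]) (by linarith [h.2])
  have h1 : 4 * p * (1 - p) ≤ 1 := by nlinarith [sq_nonneg (2 * p - 1)]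
  have hm' : (1:ℝ) ≤ m := by exact_mod_cast hm
  refine ⟨by positivity, ?_⟩
  rw [div_le_one (by linarith)]
  exact (pow_le_one₀ h0 h1).trans (by linarith)

lemma sub_ge {n m l : ℕ} [NeZero n] (hm : 0 < m) (hn : 2 * m ≤ n) (c : ℤ) (j : ℕ) :
    (if l ≤ j + 5 ∧ j < l then p ^ (2 * m) else 1) * ((4 * p * (1 - p)) ^ m / (2 * m)) ≤
    (PM (Option (ZMod n)) p).real {σ | Sub m l c j (cfg σ)} := by
  have h := hp.out
  have hb := beta_mem p m hm
  have hcard : (win n (c + 2 * m * j) (c + 2 * m * j + 2 * m)).card = 2 * m := by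
    rw [win_card] <;> omega
  split_ifs with h1
  · refine (mul_le_of_le_one_right (pow_nonneg h.1 _) hb.2).trans ?_
    have := allval p (win n (c + 2 * m * j) (c + 2 * m * j + 2 * m)) true
    rw [hcard, if_pos rfl] at this
    rw [← this]
    apply mono
    intro σ hσ
    simp only [Set.mem_ofPred_eq] at hσ ⊢
    unfold Sub
    rw [if_pos h1]
    intro i h2 h3
    exact hσ _ (Finset.mem_image.2 ⟨i, by simp [h2, h3], rfl⟩)
  · rw [one_mul]
    refine (half_ge p m hm _ hcard).trans ?_
    apply mono
    intro σ hσ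
    simp only [Set.mem_ofPred_eq] at hσ ⊢
    unfold Sub
    rw [if_neg h1, N_cfg (by omega)]
    exact hσ

lemma nuc_ge {n m l : ℕ} [NeZero n] (hm : 0 < m) (hl : 0 < l) (hn : 4 * m * l ≤ n) (c : ℤ) :
    nu p m l ≤ (PM (Option (ZMod n)) p).real {σ | Nuc m l c (cfg σ)} := by
  have h := hp.out
  have hb := beta_mem p m hm
  have h1 := indep p (Finset.range (2 * l))
    (fun j => win n (c + 2 * m * j) (c + 2 * m * j + 2 * m))
    (fun j => {σ | Sub m l c j (cfg σ)}) ?_ ?_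
  · have h2 : {σ : Option (ZMod n) → Bool | Nuc m l c (cfg σ)}
        = {σ | ∀ j ∈ Finset.range (2 * l), σ ∈ {σ | Sub m l c j (cfg σ)}} := by
      ext σ; simp [Nuc]
    rw [h2, h1]
    have h2m : 2 * m ≤ n := by
      have : 4 * m * 1 ≤ 4 * m * l := Nat.mul_le_mul_left _ hl
      omega
    refine le_trans ?_ (Finset.prod_le_prod (fun j _ => ?_)
      (fun j _ => sub_ge p (l := l) hm h2m c j))
    · rw [Finset.prod_mul_distrib, Finset.prod_const, Finset.card_range, nu]
      refine mul_le_mul_of_nonneg_right ?_ (pow_nonneg hb.1 _)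
      rw [Finset.prod_ite, Finset.prod_const_one, mul_one, Finset.prod_const, ← pow_mul]
      apply pow_le_pow_of_le_one h.1 h.2
      have : (Finset.filter (fun j => l ≤ j + 5 ∧ j < l) (Finset.range (2 * l))).card ≤ 5 := by
        calc _ ≤ (Finset.Ico (l - 5) l).card := by
              apply Finset.card_le_card
              intro j hj
              simp at hj ⊢; omega
          _ ≤ 5 := by simp; omega
      calc 2 * m * _ ≤ 2 * m * 5 := Nat.mul_le_mul_left _ this
        _ = 10 * m := by ring
    · refine mul_nonneg ?_ hb.1
      split_ifs
      · exact pow_nonneg h.1 _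
      · exact zero_le_one
  · have key : ∀ i j : ℕ, i < j → j < 2 * l →
        Disjoint (win n (c + 2 * m * i) (c + 2 * m * i + 2 * m))
          (win n (c + 2 * m * j) (c + 2 * m * j + 2 * m)) := by
      intro i j hij hj
      apply win_disj
      · have : 2 * m * (i + 1) ≤ 2 * m * j := Nat.mul_le_mul_left _ hij
        zify at this; linarith
      · have : 2 * m * (j + 1) ≤ 2 * m * (2 * l) := Nat.mul_le_mul_left _ hj
        zify at this hn
        have h0 : (0:ℤ) ≤ 2 * m * i := by positivity
        linarith
    intro i hi j hj hij
    rw [Finset.mem_range] at hi hj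
    rcases lt_or_gt_of_ne hij with h | h
    · exact key i j h hj
    · exact (key j i h hi).symm
  · intro j _
    exact dep_win _ (fun s t => Sub.congr)

lemma Nuc.congr {m l : ℕ} {c : ℤ} {s t : ℤ → Bool}
    (h : ∀ i, c ≤ i → i < c + 4 * m * l → s i = t i) (hs : Nuc m l c s) :
    Nuc m l c t := by
  intro j hj
  refine Sub.congr (fun i h1 h2 => h i ?_ ?_) (hs j hj)
  · have h0 : (0:ℤ) ≤ 2 * m * j := by positivity
    linarith
  · have : 2 * m * (j + 1) ≤ 2 * m * (2 * l) := Nat.mul_le_mul_left _ hj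
    zify at this
    linarith

lemma nonuc_le {n m l K : ℕ} [NeZero n] (hm : 0 < m) (hl : 0 < l) (hK : 0 < K)
    (hn : 4 * m * l * K ≤ n) (S : ℤ) :
    (PM (Option (ZMod n)) p).real {σ | ∀ k < K, ¬ Nuc m l (S + 4 * m * l * k) (cfg σ)}
      ≤ (1 - nu p m l) ^ K := by
  have hn4 : 4 * m * l ≤ n := (Nat.le_mul_of_pos_right _ hK).trans hn
  have h1 := indep p (Finset.range K)
    (fun k => win n (S + 4 * m * l * k) (S + 4 * m * l * k + 4 * m * l))
    (fun k => {σ | Nuc m l (S + 4 * m * l * k) (cfg σ)}ᶜ) ?_ ?_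
  · have h2 : {σ : Option (ZMod n) → Bool | ∀ k < K, ¬ Nuc m l (S + 4 * m * l * k) (cfg σ)}
        = {σ | ∀ k ∈ Finset.range K, σ ∈ {σ | Nuc m l (S + 4 * m * l * k) (cfg σ)}ᶜ} := by
      ext σ; simp
    rw [h2, h1]
    calc _ ≤ ∏ k ∈ Finset.range K, (1 - nu p m l) := by
          refine Finset.prod_le_prod (fun _ _ => measureReal_nonneg) (fun k _ => ?_)
          rw [probReal_compl_eq_one_sub (meas _)]
          linarith [nuc_ge p (n := n) hm hl hn4 (S + 4 * m * l * k)]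
      _ = _ := by simp
  · have key : ∀ i j : ℕ, i < j → j < K →
        Disjoint (win n (S + 4 * m * l * i) (S + 4 * m * l * i + 4 * m * l))
          (win n (S + 4 * m * l * j) (S + 4 * m * l * j + 4 * m * l)) := by
      intro i j hij hj
      apply win_disj
      · have : 4 * m * l * (i + 1) ≤ 4 * m * l * j := Nat.mul_le_mul_left _ hij
        zify at this; linarith
      · have : 4 * m * l * (j + 1) ≤ 4 * m * l * K := Nat.mul_le_mul_left _ hj
        zify at this hn
        have h0 : (0:ℤ) ≤ 4 * m * l * i := by positivity
        linarith
    intro i hi j hj hij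
    rw [Finset.mem_range] at hi hj
    rcases lt_or_gt_of_ne hij with h | h
    · exact key i j h hj
    · exact (key j i h hi).symm
  · intro j _
    exact (dep_win _ (fun s t => Nuc.congr)).compl

lemma bad_le {n m l r K : ℕ} [NeZero n] (hm : 0 < m) (hl : 0 < l) (hK : 0 < K)
    (hn : 32 * m * l * K ≤ n) (hr : r + 1 ≤ n) (S : ℤ) :
    (PM (Option (ZMod n)) p).real {σ | ¬ Good m l r K S (cfg σ)}
      ≤ (1 - nu p m l) ^ K + (32 * m * l * K : ℕ) * (1 - p) ^ (r + 1) := by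
  have hn4 : 4 * m * l * K ≤ n := by
    have : 32 * m * l * K = 8 * (4 * m * l * K) := by ring
    omega
  have hsub : {σ : Option (ZMod n) → Bool | ¬ Good m l r K S (cfg σ)} ⊆
      {σ | ∀ k < K, ¬ Nuc m l (S + 4 * m * l * k) (cfg σ)} ∪
      ⋃ i ∈ Finset.range (32 * m * l * K), {σ | ∀ v ∈ win n (S + i) (S + i + r + 1), σ v = false} := by
    intro σ hσ
    by_cases h1 : ∀ k < K, ¬ Nuc m l (S + 4 * m * l * k) (cfg σ)
    · exact Or.inl h1
    · right
      push Not at h1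
      simp only [Set.mem_ofPred_eq, Good, not_and] at hσ
      have h2 := hσ h1
      push Not at h2
      obtain ⟨i, hi, hi2⟩ := h2
      simp only [Set.mem_iUnion, Finset.mem_range]
      refine ⟨i, by omega, ?_⟩
      intro v hv
      simp only [win, Finset.mem_image, Finset.mem_Ico] at hv
      obtain ⟨z, hz, rfl⟩ := hv
      have := hi2 (z - (S + i)).toNat (by omega)
      have e : S + i + ((z - (S + i)).toNat : ℤ) = z := by omega
      rw [e] at this
      simpa [cfg] using this
  refine (mono p hsub).trans ((measureReal_union_le _ _).trans (add_le_add
    (nonuc_le p hm hl hK hn4 S) ((measureReal_biUnion_finset_le _ _).trans ?_)))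
  calc _ ≤ ∑ i ∈ Finset.range (32 * m * l * K), (1 - p) ^ (r + 1) := by
        refine Finset.sum_le_sum fun i _ => ?_
        rw [allval, win_card (by omega)]
        have : (S + i + r + 1 - (S + i)).toNat = r + 1 := by omega
        rw [this]; simp
    _ = _ := by simp

lemma Good.congr {m l r K : ℕ} {S : ℤ} {s t : ℤ → Bool} 
    (h : ∀ i, S ≤ i → i < S + (32 * m * l * K : ℕ) → s i = t i) (hs : Good m l r K S s) :
    Good m l r K S t := by
  obtain ⟨⟨k, hk, h1⟩, h2⟩ := hs
  refine ⟨⟨k, hk, Nuc.congr (fun i h3 h4 => h i ?_ ?_) h1⟩, ?_⟩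
  · have h0 : (0:ℤ) ≤ 4 * m * l * k := by positivity
    linarith
  · have : 4 * m * l * (k + 1) ≤ 4 * m * l * K := Nat.mul_le_mul_left _ hk
    have h0 : (0:ℤ) ≤ 28 * m * l * K := by positivity
    push_cast
    zify at this
    linarith
  · intro i hi
    obtain ⟨j, hj, h5⟩ := h2 i hi
    refine ⟨j, hj, ?_⟩
    rw [← h]
    · exact h5
    · omega
    · omega

lemma manybad_le {n m l r K k : ℕ} [NeZero n] (hm : 0 < m) (hl : 0 < l) (hK : 0 < K)
    (hk : 0 < k) (hn : k * (32 * m * l * K) ≤ n) (hr : r + 1 ≤ n)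
    (hsmall : (1 - nu p m l) ^ K + (32 * m * l * K : ℕ) * (1 - p) ^ (r + 1) ≤ (1 / 2) ^ 8) :
    (PM (Option (ZMod n)) p).real {σ | ∃ J ⊆ Finset.range k, k ≤ 4 * J.card ∧
      ∀ s ∈ J, ¬ Good m l r K ((s * (32 * m * l * K) : ℕ) : ℤ) (cfg σ)} ≤ (1 / 2) ^ k := by
  have hn1 : 32 * m * l * K ≤ n := (Nat.le_mul_of_pos_left _ hk).trans hn
  have hsub : {σ : Option (ZMod n) → Bool | ∃ J ⊆ Finset.range k, k ≤ 4 * J.card ∧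
      ∀ s ∈ J, ¬ Good m l r K ((s * (32 * m * l * K) : ℕ) : ℤ) (cfg σ)} ⊆
      ⋃ J ∈ (Finset.range k).powerset.filter (fun J => k ≤ 4 * J.card),
        {σ | ∀ s ∈ J, σ ∈ {σ | Good m l r K ((s * (32 * m * l * K) : ℕ) : ℤ) (cfg σ)}ᶜ} := by
    rintro σ ⟨J, h1, h2, h3⟩
    simp only [Set.mem_iUnion, Finset.mem_filter, Finset.mem_powerset]
    exact ⟨J, ⟨h1, h2⟩, h3⟩
  refine (mono p hsub).trans ((measureReal_biUnion_finset_le _ _).trans ?_)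
  calc _ ≤ ∑ J ∈ (Finset.range k).powerset.filter (fun J => k ≤ 4 * J.card), ((1:ℝ) / 4) ^ k := by
        refine Finset.sum_le_sum fun J hJ => ?_
        rw [Finset.mem_filter, Finset.mem_powerset] at hJ
        rw [indep p J (fun s => win n ((s * (32 * m * l * K) : ℕ) : ℤ)
          (((s * (32 * m * l * K) : ℕ) : ℤ) + (32 * m * l * K : ℕ)))]
        · calc _ ≤ ∏ s ∈ J, ((1:ℝ) / 2) ^ 8 := by
                refine Finset.prod_le_prod (fun _ _ => measureReal_nonneg) (fun s _ => ?_)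
                exact (bad_le p (r := r) hm hl hK hn1 hr _).trans hsmall
            _ = ((1:ℝ) / 4) ^ (4 * J.card) := by
                rw [Finset.prod_const, pow_mul]; norm_num
            _ ≤ _ := pow_le_pow_of_le_one (by norm_num) (by norm_num) hJ.2
        · have key : ∀ i j : ℕ, i < j → j < k →
              Disjoint (win n ((i * (32 * m * l * K) : ℕ) : ℤ)
                (((i * (32 * m * l * K) : ℕ) : ℤ) + (32 * m * l * K : ℕ)))
              (win n ((j * (32 * m * l * K) : ℕ) : ℤ)
                (((j * (32 * m * l * K) : ℕ) : ℤ) + (32 * m * l * K : ℕ))) := by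
            intro i j hij hj
            generalize 32 * m * l * K = M at *
            have h1 : (i + 1) * M ≤ j * M := Nat.mul_le_mul_right _ hij
            have h2 : (j + 1) * M ≤ k * M := Nat.mul_le_mul_right _ hj
            rw [add_mul, one_mul] at h1 h2
            apply win_disj <;> omega
          intro i hi j hj hij
          have hi := Finset.mem_range.1 (hJ.1 hi)
          have hj := Finset.mem_range.1 (hJ.1 hj)
          rcases lt_or_gt_of_ne hij with h | h
          · exact key i j h hj
          · exact (key j i h hi).symm
        · intro s _
          exact (dep_win _ (fun s t => Good.congr)).compl
    _ ≤ ∑ J ∈ (Finset.range k).powerset, ((1:ℝ) / 4) ^ k := by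
        refine Finset.sum_le_sum_of_subset_of_nonneg (Finset.filter_subset _ _) ?_
        intros; positivity
    _ = _ := by
        rw [Finset.sum_const, Finset.card_powerset, Finset.card_range, nsmul_eq_mul]
        push_cast
        rw [← mul_pow]; norm_num

end

end WH

namespace WH
open MeasureTheory ProbabilityTheory

lemma iter_fixed {V : Type} [Fintype V] (f : (V → Bool) → (V → Bool))
    (hf : ∀ σ v, σ v = true → f σ v = true) (σ : V → Bool) (M : ℕ) (hM : Fintype.card V ≤ M) :
    f (f^[M] σ) = f^[M] σ := by
  classical
  by_contra hne
  have h1 : ∀ k ≤ M, f (f^[k] σ) ≠ f^[k] σ := by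
    intro k hk heq
    apply hne
    obtain ⟨d, rfl⟩ := Nat.exists_eq_add_of_le hk
    have : f^[k + d] σ = f^[k] σ := by
      rw [add_comm, Function.iterate_add_apply]
      exact Function.iterate_fixed heq d
    rw [this, heq]
  have h2 : ∀ k ≤ M + 1, k ≤ (Finset.univ.filter (fun v => f^[k] σ v = true)).card := by
    intro k
    induction k with
    | zero => simp
    | succ k ih =>
      intro hk
      have h3 := ih (by omega)
      refine Nat.lt_of_le_of_lt h3 (Finset.card_lt_card ?_)
      rw [Function.iterate_succ_apply']
      refine Finset.ssubset_iff_subset_ne.2 ⟨?_, ?_⟩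
      · intro v hv
        simp only [Finset.mem_filter, Finset.mem_univ, true_and] at hv ⊢
        exact hf _ v hv
      · intro heq
        apply h1 k (by omega)
        funext v
        have := Finset.ext_iff.1 heq v
        simp only [Finset.mem_filter, Finset.mem_univ, true_and] at this
        exact (Bool.eq_iff_iff.2 this).symm
  have h3 := h2 (M + 1) le_rfl
  have h4 := Finset.card_le_univ (Finset.univ.filter (fun v => f^[M+1] σ v = true))
  omega

lemma iter_infl {V : Type} (f : (V → Bool) → (V → Bool))
    (hf : ∀ σ v, σ v = true → f σ v = true) (σ : V → Bool) (M : ℕ) (v : V) (h : σ v = true) :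
    f^[M] σ v = true := by
  induction M with
  | zero => exact h
  | succ k ih => rw [Function.iterate_succ_apply']; exact hf _ _ ih

lemma wheelStep_infl (n r : ℕ) [NeZero n] (σ : Option (ZMod n) → Bool) (v : Option (ZMod n))
    (h : σ v = true) : wheelStep n r σ v = true := by
  cases v <;> simp [wheelStep, h]

lemma wheelNbrs_eq (n r : ℕ) (σ : Option (ZMod n) → Bool) (i : ℤ) :
    wheelNbrs n r σ (i : ZMod n) = (if σ none then 1 else 0) +
      N (cfg σ) (i + 1) (i + r + 1) + N (cfg σ) (i - r) i := by
  rw [← sum_right, ← sum_left, add_assoc, ← Finset.sum_add_distrib]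
  simp [wheelNbrs, cfg]

lemma closed_of_fixed {n r : ℕ} [NeZero n] {T : Option (ZMod n) → Bool}
    (hT : wheelStep n r T = T) : Closed (if T none then 1 else 0) r (cfg T) := by
  intro i hi
  have h1 := congrFun hT (some (i : ZMod n))
  have h2 : T (some (i : ZMod n)) = false := hi
  simp only [wheelStep, h2, Bool.false_or, decide_eq_false_iff_not] at h1
  rw [wheelNbrs_eq] at h1
  omega

lemma perc {n m l r K k : ℕ} [NeZero n] (hm : 0 < m) (hr : 10 * m ≤ r)
    (hl : r < 2 * m * l) (hK : 0 < K) (hk : 8 ≤ k) (hn : k * (32 * m * l * K) ≤ n)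
    (hn2 : n < (k + 1) * (32 * m * l * K)) (σ : Option (ZMod n) → Bool)
    (hσ : ¬ ∃ J ⊆ Finset.range k, k ≤ 4 * J.card ∧
      ∀ s ∈ J, ¬ Good m l r K ((s * (32 * m * l * K) : ℕ) : ℤ) (cfg σ)) :
    ∀ v, wheelFix n r σ v = true := by
  classical
  have hfix : wheelStep n r (wheelFix n r σ) = wheelFix n r σ := by
    apply iter_fixed _ (wheelStep_infl n r)
    simp [ZMod.card]
  have hinf : ∀ v, σ v = true → wheelFix n r σ v = true :=
    fun v hv => iter_infl _ (wheelStep_infl n r) σ _ v hv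
  generalize wheelFix n r σ = T at *
  have hcl := closed_of_fixed hfix
  have hcl0 : Closed 0 r (cfg T) := by
    intro i hi
    have := hcl i hi
    omega
  have hst : ∀ i, cfg σ i = true → cfg T i = true := fun i hi => hinf _ hi
  -- good segments
  set J := (Finset.range k).filter
    (fun s => Good m l r K ((s * (32 * m * l * K) : ℕ) : ℤ) (cfg σ)) with hJ
  have hJc : 3 * k ≤ 4 * J.card := by
    by_contra hcon
    apply hσ
    refine ⟨(Finset.range k).filter
      (fun s => ¬ Good m l r K ((s * (32 * m * l * K) : ℕ) : ℤ) (cfg σ)),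
      Finset.filter_subset _ _, ?_, ?_⟩
    · have := Finset.card_filter_add_card_filter_not (s := Finset.range k)
        (fun s => Good m l r K ((s * (32 * m * l * K) : ℕ) : ℤ) (cfg σ))
      rw [Finset.card_range] at this
      rw [hJ] at hcon
      have h3 : ((Finset.range k).filter
          (fun s => Good m l r K ((s * (32 * m * l * K) : ℕ) : ℤ) (cfg σ))).card +
        ((Finset.range k).filter
          (fun s => ¬ Good m l r K ((s * (32 * m * l * K) : ℕ) : ℤ) (cfg σ))).card = k := by
        convert this
      omega
    · intro s hs
      exact (Finset.mem_filter.1 hs).2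
  have hact : ∀ s ∈ J, ∀ d < 24 * m * l * K,
      T (some ((s * (32 * m * l * K) + 4 * m * l * K + d : ℕ) : ZMod n)) = true := by
    intro s hs d hd
    have := (Finset.mem_filter.1 hs).2.active hm hr hl hcl0 hst d hd
    unfold cfg at this
    rw [← this]
    push_cast; rfl
  have hrc : r ≤ 24 * m * l * K := by
    calc r ≤ 2 * m * l := hl.le
      _ ≤ 24 * m * l := by nlinarith [Nat.zero_le (m * l)]
      _ ≤ _ := Nat.le_mul_of_pos_right _ hK
  have e1 : 32 * m * l * K = 8 * (4 * m * l * K) := by ring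
  have e2 : 24 * m * l * K = 6 * (4 * m * l * K) := by ring
  rw [e1] at hn hn2 hact
  rw [e2] at hact hrc
  clear_value J
  generalize 4 * m * l * K = c at *
  have hJr : ∀ s ∈ J, s < k := by
    intro s hs; rw [hJ] at hs; exact Finset.mem_range.1 (Finset.mem_filter.1 hs).1
  have hcard : J.card * (6 * c) ≤
      (Finset.univ.filter (fun i : ZMod n => T (some i) = true)).card := by
    have : J.card * (6 * c) = (J ×ˢ Finset.range (6 * c)).card := by simp
    rw [this]
    apply Finset.card_le_card_of_injOn
      (fun x : ℕ × ℕ => ((x.1 * (8 * c) + c + x.2 : ℕ) : ZMod n))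
    · rintro ⟨s, d⟩ hx
      simp only [Finset.coe_product, Set.mem_prod, Finset.mem_coe, Finset.mem_range] at hx
      simpa using hact s hx.1 d hx.2
    · rintro ⟨s, d⟩ hx ⟨s', d'⟩ hx' he
      simp only [Finset.coe_product, Set.mem_prod, Finset.mem_coe, Finset.mem_range] at hx hx' he
      have bound : ∀ s d, s ∈ J → d < 6 * c → s * (8 * c) + c + d < n := by
        intro s d hs hd
        have : (s + 1) * (8 * c) ≤ k * (8 * c) := Nat.mul_le_mul_right _ (hJr s hs)
        rw [add_mul] at this
        omega
      rw [ZMod.natCast_eq_natCast_iff'] at he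
      rw [Nat.mod_eq_of_lt (bound s d hx.1 hx.2), Nat.mod_eq_of_lt (bound s' d' hx'.1 hx'.2)] at he
      have key : ∀ a b : ℕ, a < b → a * (8 * c) + 8 * c ≤ b * (8 * c) := by
        intro a b hab
        have : (a + 1) * (8 * c) ≤ b * (8 * c) := Nat.mul_le_mul_right _ hab
        rw [add_mul] at this; omega
      have hss : s = s' := by
        rcases lt_trichotomy s s' with h | h | h
        · have := key _ _ h; omega
        · exact h
        · have := key _ _ h; omega
      subst hss
      simp; omega
  have hnone : T none = true := by
    have h1 := congrFun hfix none
    by_contra hcon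
    have hcon : T none = false := by simpa using hcon
    simp only [wheelStep, hcon, Bool.false_or, decide_eq_false_iff_not] at h1
    apply h1
    have h2 : 3 * k * (6 * c) ≤ 4 * J.card * (6 * c) := Nat.mul_le_mul_right _ hJc
    have h3 : 8 * c ≤ k * c := Nat.mul_le_mul_right _ hk
    nlinarith
  rw [hnone, if_pos rfl] at hcl
  have hne : J.Nonempty := by
    rw [← Finset.card_pos]; omega
  obtain ⟨s, hs⟩ := hne
  have hall := spread1 hcl (x := ((s * (8 * c) + c : ℕ) : ℤ)) (by
    intro i h1 h2
    have := hact s hs (i - ((s * (8 * c) + c : ℕ) : ℤ)).toNat (by omega)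
    unfold cfg
    rw [← this]
    have e : i = ((s * (8 * c) + c + (i - ((s * (8 * c) + c : ℕ) : ℤ)).toNat : ℕ) : ℤ) := by omega
    congr 2
    conv_lhs => rw [e]
    rw [Int.cast_natCast])
  intro v
  cases v with
  | none => exact hnone
  | some v =>
    have := hall (v - ((s * (8 * c) + c : ℕ) : ZMod n)).val
    unfold cfg at this
    rw [← this]
    congr 2
    push_cast
    rw [ZMod.natCast_zmod_val]
    ring_nf

lemma pW_ge (p : ℝ) [hp : Fact (p ∈ Set.Icc (0:ℝ) 1)] {n m l r K k : ℕ} (hm : 0 < m)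
    (hr : 10 * m ≤ r)
    (hl : r < 2 * m * l) (hK : 0 < K) (hk : 8 ≤ k) (hn : k * (32 * m * l * K) ≤ n)
    (hn2 : n < (k + 1) * (32 * m * l * K))
    (hsmall : (1 - nu p m l) ^ K + (32 * m * l * K : ℕ) * (1 - p) ^ (r + 1) ≤ (1 / 2) ^ 8) :
    1 - (1 / 2) ^ k ≤ pW r p n := by
  have hl0 : 0 < l := by
    rcases Nat.eq_zero_or_pos l with rfl | h
    · simp at hl
    · exact h
  have hM : r + 1 ≤ n := by
    refine le_trans ?_ hn
    calc r + 1 ≤ 2 * m * l := hl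
      _ ≤ 32 * m * l := by nlinarith [Nat.zero_le (m * l)]
      _ ≤ 32 * m * l * K := Nat.le_mul_of_pos_right _ hK
      _ ≤ _ := Nat.le_mul_of_pos_left _ (by omega)
  have hn0 : n ≠ 0 := by omega
  have : NeZero n := ⟨hn0⟩
  unfold pW
  rw [dif_neg hn0, pr_eq]
  have h1 := manybad_le p (n := n) (r := r) hm hl0 hK (by omega : 0 < k) hn hM hsmall
  have h2 := probReal_compl_eq_one_sub (μ := PM (Option (ZMod n)) p) (meas {σ | ∃ J ⊆ Finset.range k, k ≤ 4 * J.card ∧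
      ∀ s ∈ J, ¬ Good m l r K ((s * (32 * m * l * K) : ℕ) : ℤ) (cfg σ)})
  refine le_trans (by linarith) (h2.symm.le.trans (mono p ?_))
  intro σ hσ
  exact perc hm hr hl hK hk hn hn2 σ hσ

lemma pW_mem (p : ℝ) [hp : Fact (p ∈ Set.Icc (0:ℝ) 1)] (r n : ℕ) :
    0 ≤ pW r p n ∧ pW r p n ≤ 1 := by
  unfold pW
  split_ifs with h
  · simp
  · have : NeZero n := ⟨h⟩
    rw [pr_eq]
    exact ⟨measureReal_nonneg, measureReal_le_one⟩

lemma pW_tendsto (p : ℝ) [hp : Fact (p ∈ Set.Icc (0:ℝ) 1)] {m l r K : ℕ} (hm : 0 < m)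
    (hr : 10 * m ≤ r) (hl : r < 2 * m * l) (hK : 0 < K)
    (hsmall : (1 - nu p m l) ^ K + (32 * m * l * K : ℕ) * (1 - p) ^ (r + 1) ≤ (1 / 2) ^ 8) :
    Filter.Tendsto (fun n => pW r p n) Filter.atTop (nhds 1) := by
  have hM : 0 < 32 * m * l * K := by
    have : 0 < 2 * m * l := by omega
    have : 32 * m * l * K = 16 * ((2 * m * l) * K) := by ring
    rw [this]; positivity
  have hdiv : Filter.Tendsto (fun n : ℕ => n / (32 * m * l * K)) Filter.atTop Filter.atTop :=
    Nat.tendsto_div_const_atTop hM.ne'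
  have h0 : Filter.Tendsto (fun n : ℕ => 1 - ((1:ℝ) / 2) ^ (n / (32 * m * l * K)))
      Filter.atTop (nhds (1 - 0)) :=
    tendsto_const_nhds.sub
      ((tendsto_pow_atTop_nhds_zero_of_lt_one (by norm_num) (by norm_num)).comp hdiv)
  rw [sub_zero] at h0
  refine tendsto_of_tendsto_of_tendsto_of_le_of_le' h0 tendsto_const_nhds ?_
    (Filter.Eventually.of_forall fun n => (pW_mem p r n).2)
  filter_upwards [hdiv.eventually_ge_atTop 8] with n hn
  refine pW_ge p hm hr hl hK hn ?_ ?_ hsmall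
  · exact Nat.div_mul_le_self _ _
  · rw [add_mul, one_mul, mul_comm]
    exact Nat.lt_mul_div_succ n hM |>.trans_le (by rw [mul_add, mul_one])

end WH

namespace WH
open MeasureTheory ProbabilityTheory

lemma upper (p : ℝ) (h1 : 1 / 4 < p) (h2 : p ≤ 1 / 2) :
    ∀ᶠ r : ℕ in Filter.atTop, p ∈ {p : ℝ | p ∈ Set.Icc (0:ℝ) 1 ∧
      Filter.liminf (fun n => pW r p n) Filter.atTop = 1} := by
  have hmem : p ∈ Set.Icc (0:ℝ) 1 := ⟨by linarith, by linarith⟩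
  have : Fact (p ∈ Set.Icc (0:ℝ) 1) := ⟨hmem⟩
  have hp0 : 0 < p := by linarith
  have hq0 : 0 < 1 - p := by linarith
  have hq1 : 1 - p ≤ 1 := by linarith
  -- choice of `m`
  obtain ⟨m, hm, hmg⟩ : ∃ m : ℕ, 0 < m ∧ 4 * (m:ℝ) ≤ (4 * p) ^ m := by
    have ht := tendsto_pow_const_div_const_pow_of_one_lt 1 (r := 4 * p) (by linarith)
    have he := (ht.eventually (gt_mem_nhds (show (0:ℝ) < 1 / 4 by norm_num))).and
      (Filter.eventually_gt_atTop 0)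
    obtain ⟨m, hm, hm0⟩ := he.exists
    refine ⟨m, hm0, ?_⟩
    have : 0 < (4 * p) ^ m := by positivity
    rw [div_lt_iff₀ this, pow_one] at hm
    linarith
  have hm' : (0:ℝ) < m := by exact_mod_cast hm
  set β := (4 * p * (1 - p)) ^ m / (2 * m) with hβ
  have hβ0 : 0 < β := by positivity
  have hβ1 : β ≤ 1 := (beta_mem p m hm).2
  have hβq : 2 * (1 - p) ^ m ≤ β := by
    rw [hβ, mul_pow, le_div_iff₀ (by positivity)]
    have : 0 < (1 - p) ^ m := by positivity
    nlinarith
  set c1 := p ^ (10 * m) * β ^ 2 with hc1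
  have hc10 : 0 < c1 := by positivity
  have hnu : ∀ t : ℕ, c1 * 4 ^ t * (1 - p) ^ (2 * m * t) ≤ nu p m (t + 1) := by
    intro t
    have e : nu p m (t + 1) = c1 * (β ^ 2) ^ t := by
      rw [nu, ← hβ, hc1]; ring
    have e2 : (4:ℝ) ^ t * (1 - p) ^ (2 * m * t) = ((2 * (1 - p) ^ m) ^ 2) ^ t := by
      have : (2 * (1 - p) ^ m) ^ 2 = 4 * (1 - p) ^ (2 * m) := by
        rw [mul_pow, ← pow_mul, mul_comm m 2]; norm_num
      rw [this, mul_pow, ← pow_mul]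
    rw [e, mul_assoc, e2]
    gcongr
  have hnu0 : ∀ t : ℕ, 0 < nu p m (t + 1) := fun t => lt_of_lt_of_le (by positivity) (hnu t)
  have hnu1 : ∀ t : ℕ, nu p m (t + 1) ≤ 1 := by
    intro t
    rw [nu, ← hβ]
    exact mul_le_one₀ (pow_le_one₀ hp0.le (by linarith)) (by positivity) (pow_le_one₀ hβ0.le hβ1)
  -- limit
  have hlim : Filter.Tendsto (fun t : ℕ => (320 * m / c1) * ((t:ℝ) ^ 1 / 4 ^ t + (1 / 4) ^ t))
      Filter.atTop (nhds ((320 * m / c1) * (0 + 0))) :=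
    ((tendsto_pow_const_div_const_pow_of_one_lt 1 (by norm_num)).add
      (tendsto_pow_atTop_nhds_zero_of_lt_one (by norm_num) (by norm_num))).const_mul _
  rw [add_zero, mul_zero] at hlim
  have hdiv : Filter.Tendsto (fun r : ℕ => r / (2 * m)) Filter.atTop Filter.atTop :=
    Nat.tendsto_div_const_atTop (by omega)
  have hev := (hlim.comp hdiv).eventually (gt_mem_nhds (show (0:ℝ) < (1 / 2) ^ 9 by norm_num))
  filter_upwards [hev, Filter.eventually_ge_atTop (10 * m)] with r hr hr10
  refine ⟨hmem, ?_⟩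
  simp only [Function.comp] at hr
  have hl : r < 2 * m * (r / (2 * m) + 1) := Nat.lt_mul_div_succ r (by omega)
  have hle : 2 * m * (r / (2 * m)) ≤ r := Nat.mul_div_le r (2 * m)
  generalize r / (2 * m) = t at *
  have hν0 := hnu0 t
  have hν1 := hnu1 t
  have hν := hnu t
  set ν := nu p m (t + 1) with hνdef
  have hK1 : 9 / ν ≤ (⌈9 / ν⌉₊ : ℝ) := Nat.le_ceil _
  have hK2 : (⌈9 / ν⌉₊ : ℝ) ≤ 10 / ν := by
    have := (Nat.ceil_lt_add_one (show 0 ≤ 9 / ν by positivity)).le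
    have h3 : 1 ≤ 1 / ν := by rw [le_div_iff₀ hν0]; linarith
    have : 10 / ν = 9 / ν + 1 / ν := by ring
    linarith
  have hK : 0 < ⌈9 / ν⌉₊ := Nat.ceil_pos.2 (by positivity)
  generalize ⌈9 / ν⌉₊ = K at *
  refine (pW_tendsto p (l := t + 1) (K := K) hm hr10 hl hK ?_).liminf_eq
  rw [← hνdef]
  have hA : (1 - ν) ^ K ≤ (1 / 2) ^ 9 := by
    calc (1 - ν) ^ K ≤ (Real.exp (-ν)) ^ K := by
          apply pow_le_pow_left₀ (by linarith)
          linarith [Real.add_one_le_exp (-ν)]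
      _ = Real.exp (-(K * ν)) := by rw [← Real.exp_nat_mul]; ring_nf
      _ ≤ Real.exp (-9) := by
          apply Real.exp_le_exp.2
          rw [div_le_iff₀ hν0] at hK1
          linarith
      _ = (Real.exp (-1)) ^ 9 := by rw [← Real.exp_nat_mul]; norm_num
      _ ≤ (1 / 2) ^ 9 := by
          apply pow_le_pow_left₀ (Real.exp_pos _).le
          rw [Real.exp_neg, one_div]
          apply inv_anti₀ (by norm_num)
          linarith [Real.add_one_le_exp 1]
  have hB : ((32 * m * (t + 1) * K : ℕ) : ℝ) * (1 - p) ^ (r + 1) ≤ (1 / 2) ^ 9 := by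
    refine le_trans ?_ hr.le
    have hqp : (1 - p) ^ (r + 1) ≤ (1 - p) ^ (2 * m * t) :=
      pow_le_pow_of_le_one hq0.le hq1 (by omega)
    have hQ : 0 < (1 - p) ^ (2 * m * t) := by positivity
    set Q := (1 - p) ^ (2 * m * t)
    push_cast
    calc 32 * (m:ℝ) * (t + 1) * K * (1 - p) ^ (r + 1)
        ≤ 32 * (m:ℝ) * (t + 1) * (10 / ν) * Q := by gcongr
      _ ≤ 32 * (m:ℝ) * (t + 1) * (10 / (c1 * 4 ^ t * Q)) * Q := by gcongr
      _ = _ := by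
        rw [one_div, inv_pow]
        field_simp
        ring
  calc _ ≤ ((1:ℝ) / 2) ^ 9 + (1 / 2) ^ 9 := add_le_add hA hB
    _ = _ := by norm_num

end WH

namespace WH
open MeasureTheory ProbabilityTheory

lemma N_le (t : ℤ → Bool) (a b : ℤ) : N t a b ≤ (b - a).toNat := by
  unfold N
  exact (Finset.card_filter_le _ _).trans (by rw [Int.card_Ico])

lemma N_zero (t : ℤ → Bool) {a b : ℤ} (h : ∀ i, a ≤ i → i < b → t i = false) : N t a b = 0 := by
  unfold N
  rw [Finset.card_eq_zero, Finset.filter_eq_empty_iff]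
  intro i hi
  rw [Finset.mem_Ico] at hi
  simp [h i hi.1 hi.2]

/-- the interval `[a, b+r]` is bounded by passive blocks and has no dense site. -/
def Wit (r : ℕ) (t : ℤ → Bool) (a b : ℤ) : Prop :=
  a ≤ b ∧ (∀ i, a ≤ i → i ≤ a + r → t i = false) ∧ (∀ i, b ≤ i → i ≤ b + r → t i = false) ∧
  ∀ i, a ≤ i → i ≤ b + r → N t (i + 1) (i + r + 1) + N t (i - r) i ≤ r

def Saf (r : ℕ) (t : ℤ → Bool) (z : ℤ) : Prop :=
  t z = false ∧ ∃ a b, Wit r t a b ∧ a ≤ z ∧ z ≤ b + r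

lemma block_le {r : ℕ} {T : ℤ → Bool} {a i : ℤ} (h : ∀ j, a ≤ j → j ≤ a + r → T j = false)
    (h1 : a ≤ i) (h2 : i ≤ a + r) : N T (i + 1) (i + r + 1) + N T (i - r) i ≤ r := by
  rw [← N_add T (a := i + 1) (b := a + r + 1) (c := i + r + 1) (by omega) (by omega),
    ← N_add T (a := i - r) (b := a) (c := i) (by omega) (by omega),
    N_zero T (a := i + 1) (b := a + r + 1) (fun j _ _ => h j (by omega) (by omega)),
    N_zero T (a := a) (b := i) (fun j _ _ => h j (by omega) (by omega))]
  have e1 := N_le T (a + r + 1) (i + r + 1)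
  have e2 := N_le T (i - r) a
  omega

lemma saf_step {r : ℕ} {t T : ℤ → Bool} (hT : ∀ z, Saf r t z → T z = false) {z : ℤ}
    (hz : Saf r t z) : N T (z + 1) (z + r + 1) + N T (z - r) z ≤ r := by
  obtain ⟨h0, a, b, ⟨hab, ha, hb, hd⟩, h1, h2⟩ := hz
  have hs : ∀ i, a ≤ i → i ≤ b + r → t i = false → T i = false := fun i h3 h4 h5 =>
    hT i ⟨h5, a, b, ⟨hab, ha, hb, hd⟩, h3, h4⟩
  by_cases c1 : z ≤ a + r
  · exact block_le (fun j h3 h4 => hs j h3 (by omega) (ha j h3 h4)) h1 c1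
  by_cases c2 : b ≤ z
  · exact block_le (fun j h3 h4 => hs j (by omega) h4 (hb j h3 h4)) c2 h2
  refine le_trans ?_ (hd z h1 h2)
  have key : ∀ x y : ℤ, a ≤ x → y ≤ b + r + 1 → N T x y ≤ N t x y := by
    intro x y hx hy
    unfold N
    apply Finset.card_le_card
    intro i hi
    rw [Finset.mem_filter, Finset.mem_Ico] at hi ⊢
    refine ⟨hi.1, ?_⟩
    by_contra hcon
    have := hs i (by omega) (by omega) (by simpa using hcon)
    simp [this] at hi
  exact add_le_add (key _ _ (by omega) (by omega)) (key _ _ (by omega) (by omega))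

open Classical in
lemma not_perc {n r : ℕ} [NeZero n] (σ : Option (ZMod n) → Bool) (h0 : σ none = false)
    (hc : 2 * (Finset.univ.filter
      (fun v : ZMod n => ¬ Saf r (cfg σ) (v.val : ℤ))).card ≤ n) :
    ¬ ∀ v, wheelFix n r σ v = true := by
  have key : ∀ k, (wheelStep n r)^[k] σ none = false ∧
      ∀ z, Saf r (cfg σ) z → cfg ((wheelStep n r)^[k] σ) z = false := by
    intro k
    induction k with
    | zero => exact ⟨h0, fun z hz => hz.1⟩
    | succ k ih =>
      rw [Function.iterate_succ_apply']
      generalize (wheelStep n r)^[k] σ = T at ih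
      constructor
      · simp only [wheelStep, ih.1, Bool.false_or, decide_eq_false_iff_not]
        have : (Finset.univ.filter (fun i : ZMod n => T (some i) = true)).card ≤
          (Finset.univ.filter (fun v : ZMod n => ¬ Saf r (cfg σ) (v.val : ℤ))).card := by
          apply Finset.card_le_card
          intro v hv
          rw [Finset.mem_filter] at hv ⊢
          refine ⟨hv.1, fun hs => ?_⟩
          have := ih.2 _ hs
          unfold cfg at this
          rw [Int.cast_natCast, ZMod.natCast_zmod_val, hv.2] at this
          simp at this
        omega
      · intro z hz
        have h1 := ih.2 z hz
        have h2 : T (some (z : ZMod n)) = false := h1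
        unfold cfg
        simp only [wheelStep, h2, Bool.false_or, decide_eq_false_iff_not]
        rw [wheelNbrs_eq, ih.1]
        have := saf_step (T := cfg T) ih.2 hz
        simp only [Bool.false_eq_true, if_false]
        omega
  intro h
  have := (key (n + 1)).1
  have h2 := h none
  unfold wheelFix at h2
  rw [this] at h2
  simp at h2

section
variable (p : ℝ) [hp : Fact (p ∈ Set.Icc (0:ℝ) 1)]

/-- no passive block among `W` disjoint blocks -/
lemma noblock_le {n r W : ℕ} [NeZero n] (p0 : ℝ) (hpp : p ≤ p0) (hp1 : p0 ≤ 1) (c : ℤ)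
    (hn : W * (r + 1) ≤ n) :
    (PM (Option (ZMod n)) p).real {σ | ∀ w ∈ Finset.range W, ¬ ∀ i,
      c + w * (r + 1) ≤ i → i ≤ c + w * (r + 1) + r → cfg σ i = false}
    ≤ (1 - (1 - p0) ^ (r + 1)) ^ W := by
  have h := hp.out
  have h1 := indep p (Finset.range W)
    (fun w => win n (c + w * (r + 1)) (c + w * (r + 1) + r + 1))
    (fun w => {σ : Option (ZMod n) → Bool | ¬ ∀ i,
      c + w * (r + 1) ≤ i → i ≤ c + w * (r + 1) + r → cfg σ i = false}) ?_ ?_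
  · simp only [Set.mem_ofPred_eq] at h1
    rw [h1]
    refine (Finset.prod_le_prod (fun _ _ => measureReal_nonneg)
      (g := fun _ => 1 - (1 - p0) ^ (r + 1)) ?_).trans (by simp)
    intro w hw
    have hw' := Finset.mem_range.1 hw
    have hle : r + 1 ≤ n := by
      refine le_trans ?_ hn
      exact Nat.le_mul_of_pos_left _ (by omega)
    have h2 := allval p (win n (c + w * (r + 1)) (c + w * (r + 1) + r + 1)) false
    have hcard : (win n (c + w * (r + 1)) (c + w * (r + 1) + r + 1)).card = r + 1 := by
      rw [win_card] <;> omega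
    rw [hcard] at h2
    simp only [Bool.false_eq_true, if_false] at h2
    have h3 := probReal_compl_eq_one_sub (μ := PM (Option (ZMod n)) p)
      (meas {σ | ∀ v ∈ win n (c + w * (r + 1)) (c + w * (r + 1) + r + 1), σ v = false})
    have h4 : (1 - p0) ^ (r + 1) ≤ (1 - p) ^ (r + 1) :=
      pow_le_pow_left₀ (by linarith) (by linarith) _
    refine le_trans (mono p (B := {σ | ∀ v ∈ win n (c + w * (r + 1)) (c + w * (r + 1) + r + 1),
      σ v = false}ᶜ) ?_) (by rw [h3, h2]; linarith)
    intro σ hσ hcon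
    apply hσ
    intro i h5 h6
    exact hcon _ (Finset.mem_image.2 ⟨i, by simp only [Finset.mem_Ico]; omega, rfl⟩)
  · have key : ∀ i j : ℕ, i < j → j < W → Disjoint
        (win n (c + i * (r + 1)) (c + i * (r + 1) + r + 1))
        (win n (c + j * (r + 1)) (c + j * (r + 1) + r + 1)) := by
      intro i j hij hj
      have e1 : (i + 1) * (r + 1) ≤ j * (r + 1) := Nat.mul_le_mul_right _ hij
      have e2 : (j + 1) * (r + 1) ≤ W * (r + 1) := Nat.mul_le_mul_right _ hj
      have e3 : 0 ≤ i * (r + 1) := Nat.zero_le _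
      zify at e1 e2 e3 hn
      apply win_disj <;> linarith
    intro i hi j hj hij
    rw [Finset.mem_range] at hi hj
    rcases lt_or_gt_of_ne hij with h | h
    · exact key i j h hj
    · exact (key j i h hi).symm
  · intro w _
    refine dep_win (fun t => ¬ ∀ i,
      c + w * (r + 1) ≤ i → i ≤ c + w * (r + 1) + r → t i = false) ?_
    intro s t hst hs hcon
    apply hs
    intro i h1 h2
    rw [hst i h1 (by omega)]
    exact hcon i h1 h2

lemma dense_le {n r : ℕ} [NeZero n] (p0 : ℝ) (hpp : p ≤ p0) (hp0 : p0 ≤ 1/2) (z : ℤ)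
    (hn : 2 * r + 1 ≤ n) :
    (PM (Option (ZMod n)) p).real {σ | ¬ (N (cfg σ) (z + 1) (z + r + 1) +
      N (cfg σ) (z - r) z ≤ r)} ≤ (4 * p0 * (1 - p0)) ^ r := by
  have hd : Disjoint (win n (z - r) z) (win n (z + 1) (z + r + 1)) :=
    win_disj (by omega) (by omega)
  refine le_trans (mono p ?_) (tail_le p p0 hpp hp0 r
    (win n (z - r) z ∪ win n (z + 1) (z + r + 1)) ?_)
  · intro σ hσ
    simp only [Set.mem_ofPred_eq] at hσ ⊢
    rw [Finset.filter_union, Finset.card_union_of_disjoint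
      (Finset.disjoint_filter_filter hd), ← N_cfg (by omega), ← N_cfg (by omega)]
    omega
  · rw [Finset.card_union_of_disjoint hd, win_card (by omega), win_card (by omega)]
    omega

lemma active_le {n : ℕ} [NeZero n] (v : Option (ZMod n)) :
    (PM (Option (ZMod n)) p).real {σ | σ v = true} = p := by
  have := allval p {v} true
  simpa using this

lemma notsafe_le {n r W : ℕ} [NeZero n] (p0 : ℝ) (hpp : p ≤ p0) (hp0 : p0 ≤ 1/2) (z : ℤ)
    (hn : W * (r + 1) + 2 * r + 1 ≤ n) :
    (PM (Option (ZMod n)) p).real {σ | ¬ Saf r (cfg σ) z} ≤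
      p + 2 * (1 - (1 - p0) ^ (r + 1)) ^ W +
        (2 * W * (r + 1) + 1 : ℕ) * (4 * p0 * (1 - p0)) ^ r := by
  set A : Set (Option (ZMod n) → Bool) := {σ | σ (some (z : ZMod n)) = true} with hA
  set R : Set (Option (ZMod n) → Bool) := {σ | ∀ w ∈ Finset.range W, ¬ ∀ i,
      (z + 1) + w * (r + 1) ≤ i → i ≤ (z + 1) + w * (r + 1) + r → cfg σ i = false} with hR
  set L : Set (Option (ZMod n) → Bool) := {σ | ∀ w ∈ Finset.range W, ¬ ∀ i,
      (z - W * (r + 1)) + w * (r + 1) ≤ i → i ≤ (z - W * (r + 1)) + w * (r + 1) + r →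
        cfg σ i = false} with hL
  set D : Set (Option (ZMod n) → Bool) := ⋃ i ∈ Finset.Icc (z - W * (r + 1)) (z + W * (r + 1)),
    {σ | ¬ (N (cfg σ) (i + 1) (i + r + 1) + N (cfg σ) (i - r) i ≤ r)} with hD
  have hsub : {σ : Option (ZMod n) → Bool | ¬ Saf r (cfg σ) z} ⊆ ((A ∪ R) ∪ L) ∪ D := by
    intro σ hσ
    by_contra hcon
    simp only [Set.mem_union, not_or] at hcon
    obtain ⟨⟨⟨h1, h2⟩, h3⟩, h4⟩ := hcon
    apply hσ
    simp only [hA, Set.mem_ofPred_eq, Bool.not_eq_true] at h1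
    simp only [hR, Set.mem_ofPred_eq] at h2
    simp only [hL, Set.mem_ofPred_eq] at h3
    push Not at h2 h3
    obtain ⟨w, hw, h2⟩ := h2
    obtain ⟨w', hw', h3⟩ := h3
    simp only [hD, Set.mem_iUnion, Set.mem_ofPred_eq, not_exists, not_not] at h4
    rw [Finset.mem_range] at hw hw'
    have e1 : (w + 1) * (r + 1) ≤ W * (r + 1) := Nat.mul_le_mul_right _ hw
    have e2 : (w' + 1) * (r + 1) ≤ W * (r + 1) := Nat.mul_le_mul_right _ hw'
    have e3 : 0 ≤ w * (r + 1) := Nat.zero_le _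
    have e4 : 0 ≤ w' * (r + 1) := Nat.zero_le _
    have e5 : 0 ≤ r := Nat.zero_le _
    zify at e1 e2 e3 e4 e5
    refine ⟨h1, _, _, ⟨?_, h3, h2, ?_⟩, ?_, ?_⟩
    · linarith
    · intro i h5 h6
      apply h4 i
      rw [Finset.mem_Icc]
      constructor <;> linarith
    · linarith
    · linarith
  have hW : W * (r + 1) ≤ n := by omega
  have bA : (PM (Option (ZMod n)) p).real A = p := active_le p _
  have bR := noblock_le p p0 hpp (by linarith) (z + 1) hW
  have bL := noblock_le p p0 hpp (by linarith) (z - W * (r + 1)) hW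
  have bD : (PM (Option (ZMod n)) p).real D ≤
      (2 * W * (r + 1) + 1 : ℕ) * (4 * p0 * (1 - p0)) ^ r := by
    refine (measureReal_biUnion_finset_le _ _).trans ?_
    refine (Finset.sum_le_card_nsmul _ _ _
      (fun i _ => dense_le p p0 hpp hp0 i (by omega))).trans ?_
    rw [nsmul_eq_mul, Int.card_Icc]
    apply le_of_eq
    congr 2
    have : z + W * (r + 1) + 1 - (z - W * (r + 1)) = ((2 * W * (r + 1) + 1 : ℕ) : ℤ) := by
      push_cast; ring
    rw [this]; rfl
  have u1 := measureReal_union_le (μ := PM (Option (ZMod n)) p) ((A ∪ R) ∪ L) D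
  have u2 := measureReal_union_le (μ := PM (Option (ZMod n)) p) (A ∪ R) L
  have u3 := measureReal_union_le (μ := PM (Option (ZMod n)) p) A R
  have u4 := mono p hsub
  linarith

open Classical in
lemma pW_le {n r W : ℕ} (p0 : ℝ) (hpp : p ≤ p0) (hp0 : p0 ≤ 1/2)
    (hn : W * (r + 1) + 2 * r + 1 ≤ n) :
    pW r p n ≤ 3 * p + 2 * (2 * (1 - (1 - p0) ^ (r + 1)) ^ W +
        (2 * W * (r + 1) + 1 : ℕ) * (4 * p0 * (1 - p0)) ^ r) := by
  have hn0 : n ≠ 0 := by omega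
  have : NeZero n := ⟨hn0⟩
  unfold pW
  rw [dif_neg hn0, pr_eq]
  set X : (Option (ZMod n) → Bool) → ℝ := fun σ =>
    ((Finset.univ.filter (fun v : ZMod n => ¬ Saf r (cfg σ) (v.val : ℤ))).card : ℝ) with hX
  have hsub : {σ : Option (ZMod n) → Bool | ∀ v, wheelFix n r σ v = true} ⊆
      {σ | σ none = true} ∪ {σ | (n : ℝ) / 2 ≤ X σ} := by
    intro σ hσ
    by_contra hcon
    simp only [Set.mem_union, not_or, Set.mem_ofPred_eq, Bool.not_eq_true, not_le] at hcon
    refine not_perc (r := r) σ hcon.1 ?_ hσ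
    have : (2:ℝ) * ((Finset.univ.filter
      (fun v : ZMod n => ¬ Saf r (cfg σ) (v.val : ℤ))).card : ℝ) ≤ n := by
      have := hcon.2
      simp only [hX] at this
      linarith
    exact_mod_cast this
  have hXe : X = fun σ => ∑ v : ZMod n, Set.indicator
      {σ : Option (ZMod n) → Bool | ¬ Saf r (cfg σ) (v.val : ℤ)} (fun _ => (1:ℝ)) σ := by
    funext σ
    simp only [hX, Finset.card_filter, Set.indicator_apply, Set.mem_ofPred_eq]
    push_cast
    rfl
  have hIntg : ∀ f : (Option (ZMod n) → Bool) → ℝ, Integrable f (PM (Option (ZMod n)) p) :=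
    fun f => Integrable.of_finite
  have hE : ∫ σ, X σ ∂(PM (Option (ZMod n)) p) ≤
      n * (p + 2 * (1 - (1 - p0) ^ (r + 1)) ^ W +
        (2 * W * (r + 1) + 1 : ℕ) * (4 * p0 * (1 - p0)) ^ r) := by
    rw [hXe, integral_finsetSum _ (fun v _ => hIntg _)]
    refine (Finset.sum_le_card_nsmul _ _ (p + 2 * (1 - (1 - p0) ^ (r + 1)) ^ W +
        (2 * W * (r + 1) + 1 : ℕ) * (4 * p0 * (1 - p0)) ^ r) ?_).trans ?_
    · intro v _
      rw [integral_indicator_const _ (meas _)]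
      simp only [smul_eq_mul, mul_one]
      exact notsafe_le p p0 hpp hp0 _ hn
    · rw [nsmul_eq_mul, Finset.card_univ, ZMod.card]
  have hM := mul_meas_ge_le_integral_of_nonneg (μ := PM (Option (ZMod n)) p) (f := X)
    (Filter.Eventually.of_forall fun σ => by simp [hX]) (hIntg X) ((n:ℝ) / 2)
  have u1 := mono p hsub
  have u2 := measureReal_union_le (μ := PM (Option (ZMod n)) p)
    {σ | σ none = true} {σ | (n : ℝ) / 2 ≤ X σ}
  rw [active_le] at u2
  have hnp : (0:ℝ) < n := by exact_mod_cast Nat.pos_of_ne_zero hn0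
  have h5 := hM.trans hE
  have h6 : (PM (Option (ZMod n)) p).real {σ | (n : ℝ) / 2 ≤ X σ} ≤
      2 * (p + 2 * (1 - (1 - p0) ^ (r + 1)) ^ W +
        (2 * W * (r + 1) + 1 : ℕ) * (4 * p0 * (1 - p0)) ^ r) := by
    refine le_of_mul_le_mul_left ?_ hnp
    linarith
  linarith

end

end WH

namespace WH
open MeasureTheory ProbabilityTheory

lemma small (p0 : ℝ) (h1 : 0 ≤ p0) (h2 : p0 < 1 / 4) : ∀ᶠ r : ℕ in Filter.atTop, ∃ W : ℕ,
    2 * (1 - (1 - p0) ^ (r + 1)) ^ W +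
        (2 * W * (r + 1) + 1 : ℕ) * (4 * p0 * (1 - p0)) ^ r ≤ 1 / 16 := by
  have t1 : Filter.Tendsto (fun r : ℕ => 42 * ((r : ℝ) ^ 1 * (4 * p0) ^ r + (4 * p0) ^ r))
      Filter.atTop (nhds (42 * (0 + 0))) := by
    refine Filter.Tendsto.const_mul _ (Filter.Tendsto.add ?_ ?_)
    · exact tendsto_pow_const_mul_const_pow_of_abs_lt_one 1
        (by rw [abs_of_nonneg (by linarith)]; linarith)
    · exact tendsto_pow_atTop_nhds_zero_of_lt_one (by linarith) (by linarith)
  filter_upwards [t1.eventually_lt_const (show (42 * (0 + 0) : ℝ) < 1 / 32 by norm_num)] with r hr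
  have hq0 : 0 < 1 - p0 := by linarith
  have hx0 : 0 < (1 - p0) ^ (r + 1) := pow_pos hq0 _
  have hx1 : (1 - p0) ^ (r + 1) ≤ 1 := pow_le_one₀ hq0.le (by linarith)
  have hxe : (1 - p0) ^ (r + 1) = (1 - p0) ^ r * (1 - p0) := pow_succ _ _
  have hy0 : 0 < (1 - p0) ^ r := pow_pos hq0 _
  set x := (1 - p0) ^ (r + 1) with hx
  refine ⟨⌈6 / x⌉₊, ?_⟩
  have w1 : 6 / x ≤ (⌈6 / x⌉₊ : ℝ) := Nat.le_ceil _
  have w2 : (⌈6 / x⌉₊ : ℝ) < 6 / x + 1 := Nat.ceil_lt_add_one (by positivity)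
  generalize ⌈6 / x⌉₊ = W at *
  have w3 : 6 ≤ W * x := by rwa [div_le_iff₀ hx0] at w1
  have w4 : W * x ≤ 7 := by
    have : W * x ≤ (6 / x + 1) * x := mul_le_mul_of_nonneg_right w2.le hx0.le
    rw [add_mul, div_mul_cancel₀ _ hx0.ne'] at this
    linarith
  have a1 : (1 - x) ^ W ≤ 1 / 64 := by
    calc (1 - x) ^ W ≤ (Real.exp (-x)) ^ W :=
          pow_le_pow_left₀ (by linarith) (Real.one_sub_le_exp_neg x) _
      _ = Real.exp (-(W * x)) := by rw [← Real.exp_nat_mul]; ring_nf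
      _ ≤ Real.exp (-6) := Real.exp_le_exp.2 (by linarith)
      _ ≤ 1 / 64 := by
        have e : Real.exp 6 = (Real.exp 1) ^ 6 := by rw [← Real.exp_nat_mul]; norm_num
        have e2 : (2:ℝ) ≤ Real.exp 1 := by linarith [Real.add_one_le_exp 1]
        have e3 : (2:ℝ) ^ 6 ≤ Real.exp 6 := by rw [e]; exact pow_le_pow_left₀ (by norm_num) e2 _
        rw [Real.exp_neg, ← one_div]
        exact one_div_le_one_div_of_le (by norm_num) (by linarith)
  have a2 : ((2 * W * (r + 1) + 1 : ℕ) : ℝ) * (4 * p0 * (1 - p0)) ^ r ≤ 1 / 32 := by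
    rw [mul_pow]
    have b1 : (W : ℝ) * (1 - p0) ^ r ≤ 14 := by
      have : (W : ℝ) * (1 - p0) ^ r * (1 / 2) ≤ W * (1 - p0) ^ r * (1 - p0) :=
        mul_le_mul_of_nonneg_left (by linarith) (by positivity)
      rw [mul_assoc _ _ (1 - p0), ← hxe] at this
      linarith
    have b2 : (1 - p0) ^ r ≤ 1 := pow_le_one₀ hq0.le (by linarith)
    have b3 : 0 ≤ (4 * p0) ^ r := by positivity
    have b4 : ((2 * W * (r + 1) + 1 : ℕ) : ℝ) * (1 - p0) ^ r ≤ 42 * (r + 1) := by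
      push_cast
      have hr0 : (0:ℝ) ≤ r := Nat.cast_nonneg r
      nlinarith
    calc _ = (((2 * W * (r + 1) + 1 : ℕ) : ℝ) * (1 - p0) ^ r) * (4 * p0) ^ r := by ring
      _ ≤ (42 * (r + 1)) * (4 * p0) ^ r := mul_le_mul_of_nonneg_right b4 b3
      _ = 42 * ((r : ℝ) ^ 1 * (4 * p0) ^ r + (4 * p0) ^ r) := by ring
      _ ≤ _ := hr.le
  linarith

lemma lower (p0 : ℝ) (h1 : 0 ≤ p0) (h2 : p0 < 1 / 4) : ∀ᶠ r : ℕ in Filter.atTop, ∀ p : ℝ,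
    (p ∈ Set.Icc (0:ℝ) 1 ∧ Filter.liminf (fun n => pW r p n) Filter.atTop = 1) → p0 ≤ p := by
  filter_upwards [small p0 h1 h2] with r hr p hp
  obtain ⟨W, hW⟩ := hr
  by_contra hcon
  push Not at hcon
  have : Fact (p ∈ Set.Icc (0:ℝ) 1) := ⟨hp.1⟩
  have h3 : Filter.liminf (fun n => pW r p n) Filter.atTop ≤ 7 / 8 := by
    refine Filter.liminf_le_of_frequently_le (Filter.Eventually.frequently ?_) ?_
    · filter_upwards [Filter.eventually_ge_atTop (W * (r + 1) + 2 * r + 1)] with n hn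
      have := pW_le p p0 hcon.le (by linarith) hn
      linarith
    · exact Filter.isBoundedUnder_of ⟨0, fun n => (pW_mem p r n).1⟩
  rw [hp.2] at h3
  norm_num at h3

lemma final : Filter.Tendsto (fun r : ℕ => pcPlus r) Filter.atTop (nhds (1 / 4 : ℝ)) := by
  rw [tendsto_order]
  constructor
  · intro a ha
    have g1 : (0:ℝ) ≤ max ((a + 1/4)/2) (1/8) := le_max_of_le_right (by norm_num)
    have g2 : max ((a + 1/4)/2) (1/8) < (1:ℝ) / 4 := max_lt (by linarith) (by norm_num)
    filter_upwards [lower _ g1 g2, upper (3/8) (by norm_num) (by norm_num)] with r hr hu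
    have : max ((a + 1/4)/2) (1/8) ≤ pcPlus r := le_csInf ⟨_, hu⟩ (fun p hp => hr p hp)
    have g3 : (a + 1/4)/2 ≤ max ((a + 1/4)/2) (1/8) := le_max_left _ _
    linarith
  · intro a ha
    have g1 : (1:ℝ)/4 < min ((a + 1/4)/2) (3/8) := lt_min (by linarith) (by norm_num)
    have g2 : min ((a + 1/4)/2) (3/8) ≤ (1:ℝ)/2 := (min_le_right _ _).trans (by norm_num)
    filter_upwards [upper _ g1 g2] with r hu
    have : pcPlus r ≤ min ((a + 1/4)/2) (3/8) := csInf_le ⟨0, fun p hp => hp.1.1⟩ hu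
    have g3 : min ((a + 1/4)/2) (3/8) ≤ (a + 1/4)/2 := min_le_left _ _
    linarith

end WH

/-- The limit of `p_c^+(WH(r))`, as `r → ∞`, exists and equals `1/4`. -/
theorem pcPlus_tendsto_one_quarter :
    Filter.Tendsto (fun r : ℕ => pcPlus r) Filter.atTop (nhds (1 / 4 : ℝ)) := by
  exact WH.final
end

section
/- Let 0 < p < 1 and let r be a positive integer. Then liminf_{n→∞} p_R(n,r,p) ≤ liminf_{n→∞} p_W(n,r,p), and limsup_{n→∞} p_W(n,r,p) ≤ p + (1−p)·limsup_{n→∞} p_R(n,r,p). -/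
open Finset


open Finset

lemma rvw_fix {V : Type} [Fintype V] (f : (V → Bool) → (V → Bool))
    (hf : ∀ x v, x v = true → f x v = true) (x : V → Bool) :
    f (f^[Fintype.card V] x) = f^[Fintype.card V] x := by
  classical
  have key : ∀ k, f (f^[k] x) = f^[k] x ∨
      k ≤ (Finset.univ.filter (fun v => f^[k] x v = true)).card := by
    intro k
    induction k with
    | zero => right; simp
    | succ k ih =>
      rw [Function.iterate_succ_apply']
      by_cases h : f (f^[k] x) = f^[k] x
      · left; rw [h, h]
      · right
        have ih := ih.resolve_left h
        apply Nat.succ_le_of_lt (lt_of_le_of_lt ih _)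
        apply Finset.card_lt_card
        rw [Finset.ssubset_iff_of_subset]
        · obtain ⟨v, hv⟩ := Function.ne_iff.1 h
          refine ⟨v, ?_, ?_⟩
          · have := hf (f^[k] x) v
            simp only [Finset.mem_filter, Finset.mem_univ, true_and]
            cases h1 : f^[k] x v <;> cases h2 : f (f^[k] x) v <;> simp_all
          · have := hf (f^[k] x) v
            simp only [Finset.mem_filter, Finset.mem_univ, true_and]
            cases h1 : f^[k] x v <;> cases h2 : f (f^[k] x) v <;> simp_all
        · intro v hv
          simp only [Finset.mem_filter, Finset.mem_univ, true_and] at hv ⊢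
          exact hf _ _ hv
  rcases key (Fintype.card V) with h | h
  · exact h
  · have h2 : Finset.univ.filter (fun v => f^[Fintype.card V] x v = true) = Finset.univ :=
      Finset.eq_univ_of_card _ (le_antisymm (Finset.card_le_univ _) h)
    funext v
    have hv : v ∈ Finset.univ.filter (fun v => f^[Fintype.card V] x v = true) := by
      rw [h2]; simp
    simp only [Finset.mem_filter, Finset.mem_univ, true_and] at hv
    rw [hv, hf _ _ hv]

lemma rvw_iter_infl {V : Type} (f : (V → Bool) → (V → Bool))
    (hf : ∀ x v, x v = true → f x v = true) (x : V → Bool) (v : V) {a b : ℕ} (hab : a ≤ b)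
    (h : f^[a] x v = true) : f^[b] x v = true := by
  induction b, hab using Nat.le_induction with
  | base => exact h
  | succ b _ ih => rw [Function.iterate_succ_apply']; exact hf _ _ ih

lemma rvw_ring_infl (n r : ℕ) (x : ZMod n → Bool) (v : ZMod n) (h : x v = true) :
    ringStep n r x v = true := by simp [ringStep, h]

lemma rvw_wheel_infl (n r : ℕ) [NeZero n] (x : Option (ZMod n) → Bool) (v : Option (ZMod n))
    (h : x v = true) : wheelStep n r x v = true := by
  cases v <;> simp [wheelStep, h]

lemma rvw_wheelFix_fixed (n r : ℕ) [NeZero n] (x : Option (ZMod n) → Bool) :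
    wheelStep n r (wheelFix n r x) = wheelFix n r x := by
  have h := rvw_fix (wheelStep n r) (rvw_wheel_infl n r) x
  have hc : Fintype.card (Option (ZMod n)) = n + 1 := by simp [ZMod.card]
  rw [hc] at h
  exact h

lemma rvw_activeNbrs_mono (n r : ℕ) (x y : ZMod n → Bool)
    (h : ∀ v, x v = true → y v = true) (i : ZMod n) :
    activeNbrs n r x i ≤ activeNbrs n r y i := by
  unfold activeNbrs
  apply Finset.sum_le_sum
  intro k _
  have h1 := h (i + k)
  have h2 := h (i - k)
  apply Nat.add_le_add
  · by_cases hx : x (i + k) = true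
    · simp [hx, h1 hx]
    · simp [hx]
  · by_cases hx : x (i - k) = true
    · simp [hx, h2 hx]
    · simp [hx]

lemma rvw_wheelNbrs_eq (n r : ℕ) (x : Option (ZMod n) → Bool) (i : ZMod n) :
    wheelNbrs n r x i = (if x none then 1 else 0) + activeNbrs n r (fun j => x (some j)) i := rfl

lemma rvw_ring_le_wheel (n r : ℕ) [NeZero n] (x : Option (ZMod n) → Bool) (k : ℕ) :
    ∀ i, (ringStep n r)^[k] (fun j => x (some j)) i = true →
      wheelFix n r x (some i) = true := by
  induction k with
  | zero =>
    intro i h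
    exact rvw_iter_infl _ (rvw_wheel_infl n r) x (some i) (Nat.zero_le (n+1)) h
  | succ k ih =>
    intro i h
    rw [Function.iterate_succ_apply'] at h
    rw [← rvw_wheelFix_fixed]
    have hm := rvw_activeNbrs_mono n r _ _ ih i
    simp only [ringStep, Bool.or_eq_true, decide_eq_true_eq] at h
    rcases h with h | h
    · exact rvw_wheel_infl n r _ _ (ih i h)
    · have h3 : r + 1 ≤ wheelNbrs n r (wheelFix n r x) i := by
        rw [rvw_wheelNbrs_eq]
        exact le_trans (le_trans h hm) (Nat.le_add_left _ _)
      simp [wheelStep, h3]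

lemma rvw_wheel_eq_ring (n r : ℕ) [NeZero n] (x : Option (ZMod n) → Bool) (k : ℕ)
    (h : (wheelStep n r)^[k] x none = false) (i : ZMod n) :
    (wheelStep n r)^[k] x (some i) = (ringStep n r)^[k] (fun j => x (some j)) i := by
  induction k generalizing i with
  | zero => rfl
  | succ k ih =>
    have h0 : (wheelStep n r)^[k] x none = false := by
      by_contra hc
      have := rvw_iter_infl _ (rvw_wheel_infl n r) x none (Nat.le_succ k) (by simpa using hc)
      simp_all
    have ih' := ih h0
    rw [Function.iterate_succ_apply', Function.iterate_succ_apply']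
    have e : (fun j => (wheelStep n r)^[k] x (some j))
        = (ringStep n r)^[k] (fun j => x (some j)) := funext ih'
    simp only [wheelStep, ringStep, rvw_wheelNbrs_eq, h0, ih']
    simp

/-- If the hub starts passive and ends active, the ring has a majority. -/
lemma rvw_hub (n r : ℕ) [NeZero n] (x : Option (ZMod n) → Bool) (h0 : x none = false)
    (h : wheelFix n r x none = true) :
    n < 2 * (Finset.univ.filter
      (fun i : ZMod n => ringFix n r (fun j => x (some j)) i = true)).card := by
  have key : ∀ k, k ≤ n + 1 → (wheelStep n r)^[k] x none = true →
      n < 2 * (Finset.univ.filter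
      (fun i : ZMod n => ringFix n r (fun j => x (some j)) i = true)).card := by
    intro k
    induction k with
    | zero => intro _ hk; simp [h0] at hk
    | succ k ih =>
      intro hkn hk
      by_cases hk' : (wheelStep n r)^[k] x none = true
      · exact ih (by omega) hk'
      · have hk'' : (wheelStep n r)^[k] x none = false := by simpa using hk'
        rw [Function.iterate_succ_apply'] at hk
        simp only [wheelStep, hk'', Bool.false_or, decide_eq_true_eq] at hk
        refine lt_of_lt_of_le (Nat.lt_of_succ_le hk) (Nat.mul_le_mul_left 2 (Finset.card_le_card ?_))
        intro i hi
        simp only [Finset.mem_filter, Finset.mem_univ, true_and] at hi ⊢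
        rw [rvw_wheel_eq_ring n r x k hk''] at hi
        exact rvw_iter_infl _ (rvw_ring_infl n r) _ i (by omega) hi
  exact key (n + 1) le_rfl h

/-- Ring majority and a run of `r` active vertices imply percolation of the wheel. -/
lemma rvw_perc (n r : ℕ) [NeZero n] (x : Option (ZMod n) → Bool)
    (h : n < 2 * (Finset.univ.filter
      (fun i : ZMod n => ringFix n r (fun j => x (some j)) i = true)).card)
    (i : ZMod n) (hi : ∀ k : ℕ, k < r → x (some (i + (k : ZMod n))) = true) :
    ∀ v, wheelFix n r x v = true := by
  have hn : wheelFix n r x none = true := by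
    rw [← rvw_wheelFix_fixed]
    simp only [wheelStep, Bool.or_eq_true, decide_eq_true_eq]
    right
    refine le_trans (Nat.succ_le_of_lt h) (Nat.mul_le_mul_left 2 (Finset.card_le_card ?_))
    intro j hj
    simp only [Finset.mem_filter, Finset.mem_univ, true_and] at hj ⊢
    exact rvw_ring_le_wheel n r x n j hj
  have hall : ∀ k : ℕ, wheelFix n r x (some (i + (k : ZMod n))) = true := by
    intro k
    induction k using Nat.strong_induction_on with
    | _ k ih =>
      by_cases hk : k < r
      · exact rvw_iter_infl _ (rvw_wheel_infl n r) x _ (Nat.zero_le (n+1)) (hi k hk)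
      · rw [← rvw_wheelFix_fixed]
        simp only [wheelStep, Bool.or_eq_true, decide_eq_true_eq, rvw_wheelNbrs_eq, hn]
        right
        have : r ≤ activeNbrs n r (fun j => wheelFix n r x (some j)) (i + (k : ZMod n)) := by
          unfold activeNbrs
          calc r = ∑ _k ∈ Finset.Icc 1 r, 1 := by simp
            _ ≤ _ := by
              apply Finset.sum_le_sum
              intro j hj
              rw [Finset.mem_Icc] at hj
              have h1 := ih (k - j) (by omega)
              rw [Nat.cast_sub (by omega), ← add_sub_assoc] at h1
              simp [h1]
        simp only [if_true]
        omega
  intro v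
  cases v with
  | none => exact hn
  | some v =>
    have := hall (v - i).val
    simpa using this

lemma rvw_w_nonneg {p : ℝ} (hp : 0 < p) (hp1 : p < 1) (b : Bool) :
    0 ≤ (if b then p else 1 - p) := by
  split_ifs <;> linarith

lemma rvw_pr_mono {V : Type} [Fintype V] [DecidableEq V] {p : ℝ} (hp : 0 < p) (hp1 : p < 1)
    {S T : Set (V → Bool)} (h : S ⊆ T) : pr p S ≤ pr p T := by
  unfold pr
  apply Finset.sum_le_sum
  intro σ _
  exact Set.indicator_le_indicator_of_subset h
    (fun τ => Finset.prod_nonneg fun v _ => rvw_w_nonneg hp hp1 _) σ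

lemma rvw_pr_nonneg {V : Type} [Fintype V] [DecidableEq V] {p : ℝ} (hp : 0 < p) (hp1 : p < 1)
    (S : Set (V → Bool)) : 0 ≤ pr p S := by
  unfold pr
  apply Finset.sum_nonneg
  intro σ _
  exact Set.indicator_nonneg
    (fun τ _ => Finset.prod_nonneg fun v _ => rvw_w_nonneg hp hp1 _) σ

lemma rvw_pr_univ {V : Type} [Fintype V] [DecidableEq V] (p : ℝ) :
    pr p (Set.univ : Set (V → Bool)) = 1 := by
  unfold pr
  simp only [Set.indicator_univ]
  rw [← Fintype.prod_sum (fun (_ : V) (b : Bool) => if b then p else 1 - p)]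
  simp

lemma rvw_pr_le_one {V : Type} [Fintype V] [DecidableEq V] {p : ℝ} (hp : 0 < p) (hp1 : p < 1)
    (S : Set (V → Bool)) : pr p S ≤ 1 := by
  rw [← rvw_pr_univ (V := V) p]
  exact rvw_pr_mono hp hp1 (Set.subset_univ _)

lemma rvw_pr_union {V : Type} [Fintype V] [DecidableEq V] {p : ℝ} (hp : 0 < p) (hp1 : p < 1)
    (S T : Set (V → Bool)) : pr p (S ∪ T) ≤ pr p S + pr p T := by
  unfold pr
  rw [← Finset.sum_add_distrib]
  apply Finset.sum_le_sum
  intro σ _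
  have h0 : 0 ≤ ∏ v, (if σ v then p else 1 - p) :=
    Finset.prod_nonneg fun v _ => rvw_w_nonneg hp hp1 _
  by_cases hS : σ ∈ S <;> by_cases hT : σ ∈ T <;> simp [Set.indicator, hS, hT, h0]

/-- Marginals: product structure over a sum type. -/
lemma rvw_pr_sum {V A B : Type} [Fintype V] [DecidableEq V] [Fintype A] [DecidableEq A]
    [Fintype B] [DecidableEq B] (p : ℝ) (e : A ⊕ B ≃ V) (S : Set (V → Bool)) :
    pr p S = ∑ b : B → Bool, (∏ v, (if b v then p else 1 - p)) *
      pr p {a : A → Bool | (fun v => Sum.elim a b (e.symm v)) ∈ S} := by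
  classical
  unfold pr
  rw [← Equiv.sum_comp ((Equiv.sumArrowEquivProdArrow A B Bool).symm.trans
    (Equiv.arrowCongr e (Equiv.refl Bool)))]
  rw [Fintype.sum_prod_type_right]
  apply Finset.sum_congr rfl
  intro b _
  rw [Finset.mul_sum]
  apply Finset.sum_congr rfl
  intro a _
  have e1 : ((Equiv.sumArrowEquivProdArrow A B Bool).symm.trans
    (Equiv.arrowCongr e (Equiv.refl Bool))) (a, b) = fun v => Sum.elim a b (e.symm v) := by
    funext v
    rfl
  rw [e1]
  have e2 : ∏ v, (if Sum.elim a b (e.symm v) then p else 1 - p)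
      = (∏ v, (if a v then p else 1 - p)) * ∏ v, (if b v then p else 1 - p) := by
    rw [← Equiv.prod_comp e, Fintype.prod_sum_type]
    simp
  by_cases h : (fun v => Sum.elim a b (e.symm v)) ∈ S
  · rw [Set.indicator_of_mem h, Set.indicator_of_mem (by exact h), e2, mul_comm]
  · rw [Set.indicator_of_notMem h, Set.indicator_of_notMem (by exact h), mul_zero]

lemma rvw_pr_marg {V A : Type} [Fintype V] [DecidableEq V] [Fintype A] [DecidableEq A]
    (p : ℝ) (f : A → V) (hf : Function.Injective f) (S : Set (A → Bool)) :
    pr p {σ : V → Bool | (fun a => σ (f a)) ∈ S} = pr p S := by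
  classical
  let e : A ⊕ {v // v ∉ Set.range f} ≃ V :=
    (Equiv.sumCongr (Equiv.ofInjective f hf) (Equiv.refl _)).trans
      (Equiv.sumCompl (fun v => v ∈ Set.range f))
  have he : ∀ a, e.symm (f a) = Sum.inl a := by
    intro a
    rw [Equiv.symm_apply_eq]
    rfl
  rw [rvw_pr_sum p e]
  simp only [Set.mem_ofPred_eq, he, Sum.elim_inl]
  rw [← Finset.sum_mul]
  have := rvw_pr_univ (V := {v // v ∉ Set.range f}) p
  unfold pr at this
  simp only [Set.indicator_univ] at this
  rw [this, one_mul]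
  rfl

lemma rvw_pr_option {A : Type} [Fintype A] [DecidableEq A] {p : ℝ} (hp : 0 < p) (hp1 : p < 1)
    (S : Set (A → Bool)) :
    pr p {σ : Option A → Bool | σ none = true ∨ (fun a => σ (some a)) ∈ S}
      = p + (1 - p) * pr p S := by
  rw [rvw_pr_sum p (Equiv.optionEquivSumPUnit A).symm]
  rw [← Equiv.sum_comp (Equiv.funUnique PUnit.{1} Bool).symm]
  have := rvw_pr_univ (V := A) p
  simp [this]
  left
  rfl

lemma rvw_blocks {p : ℝ} (m r : ℕ) :
    pr p {τ : Fin m × Fin r → Bool | ∀ j, ∃ k, τ (j, k) = false} = (1 - p ^ r) ^ m := by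
  classical
  have h1 : ∑ x : Fin r → Bool, (if ∃ k, x k = false then
      ∏ k, (if x k then p else 1 - p) else 0) = 1 - p ^ r := by
    have hu := rvw_pr_univ (V := Fin r) p
    unfold pr at hu
    simp only [Set.indicator_univ] at hu
    have : ∑ x : Fin r → Bool, (if ∃ k, x k = false then (0:ℝ) else
      ∏ k, (if x k then p else 1 - p)) = p ^ r := by
      rw [Finset.sum_eq_single (fun _ => true)]
      · simp
      · intro b _ hb
        obtain ⟨k, hk⟩ := Function.ne_iff.1 hb
        rw [if_pos ⟨k, by simpa using hk⟩]
      · simp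
    rw [← this, eq_sub_iff_add_eq, ← Finset.sum_add_distrib]
    refine Eq.trans ?_ hu
    apply Finset.sum_congr rfl
    intro x _
    split_ifs <;> simp
  rw [← h1, Fintype.sum_pow]
  unfold pr
  rw [← Equiv.sum_comp (Equiv.curry (Fin m) (Fin r) Bool).symm]
  apply Finset.sum_congr rfl
  intro τ _
  rw [Set.indicator_apply]
  simp only [Set.mem_ofPred_eq, Equiv.curry_symm_apply, Function.uncurry_apply_pair,
    Fintype.prod_prod_type]
  split_ifs with h
  · apply Finset.prod_congr rfl
    intro j _
    rw [if_pos (h j)]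
    rfl
  · push Not at h
    obtain ⟨j, hj⟩ := h
    symm
    apply Finset.prod_eq_zero (Finset.mem_univ j)
    rw [if_neg]
    simpa using hj

lemma rvw_norun {p : ℝ} (hp : 0 < p) (hp1 : p < 1) (n r : ℕ) [NeZero n] :
    pr p {σ : ZMod n → Bool | ∀ i, ∃ k : ℕ, k < r ∧ σ (i + (k : ZMod n)) = false}
      ≤ (1 - p ^ r) ^ (n / r) := by
  let f : Fin (n / r) × Fin r → ZMod n := fun x => ((x.1 * r + x.2 : ℕ) : ZMod n)
  have hlt : ∀ x : Fin (n / r) × Fin r, (x.1 * r + x.2 : ℕ) < n := by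
    rintro ⟨⟨j, hj⟩, ⟨k, hk⟩⟩
    simp only
    have h1 : (j + 1) * r ≤ n / r * r := Nat.mul_le_mul_right r hj
    have h2 := Nat.div_mul_le_self n r
    rw [Nat.add_mul] at h1
    omega
  have hf : Function.Injective f := by
    intro x y hxy
    have h := congrArg ZMod.val hxy
    simp only [f] at h
    rw [ZMod.val_natCast_of_lt (hlt x), ZMod.val_natCast_of_lt (hlt y)] at h
    obtain ⟨⟨j, hj⟩, ⟨k, hk⟩⟩ := x
    obtain ⟨⟨j', hj'⟩, ⟨k', hk'⟩⟩ := y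
    simp only at h
    have hr : 0 < r := by omega
    have hk2 : k = k' := by
      have := congrArg (· % r) h
      simpa [Nat.mod_eq_of_lt hk, Nat.mod_eq_of_lt hk', Nat.add_mod] using this
    subst hk2
    have : j = j' := Nat.eq_of_mul_eq_mul_right hr (Nat.add_right_cancel h)
    subst this
    rfl
  rw [← rvw_blocks (p := p) (n / r) r, ← rvw_pr_marg p f hf]
  apply rvw_pr_mono hp hp1
  intro σ hσ j
  obtain ⟨k, hk, h⟩ := hσ ((j * r : ℕ) : ZMod n)
  refine ⟨⟨k, hk⟩, ?_⟩
  simp only [f, Nat.cast_add]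
  exact h

lemma rvw_lower {p : ℝ} (hp : 0 < p) (hp1 : p < 1) (n r : ℕ) (hn : n ≠ 0) :
    pR r p n ≤ pW r p n + (1 - p ^ r) ^ (n / r) := by
  have : NeZero n := ⟨hn⟩
  unfold pR pW
  rw [dif_neg hn, dif_neg hn]
  rw [← rvw_pr_marg p (some : ZMod n → Option (ZMod n)) (Option.some_injective _)]
  refine le_trans ?_ (add_le_add_right (rvw_norun hp hp1 n r) _)
  rw [← rvw_pr_marg p (some : ZMod n → Option (ZMod n)) (Option.some_injective _)
    {σ : ZMod n → Bool | ∀ i, ∃ k : ℕ, k < r ∧ σ (i + (k : ZMod n)) = false}]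
  refine le_trans ?_ (rvw_pr_union hp hp1 _ _)
  apply rvw_pr_mono hp hp1
  intro σ hσ
  by_cases h : ∀ i : ZMod n, ∃ k : ℕ, k < r ∧ σ (some (i + (k : ZMod n))) = false
  · right; exact h
  · left
    push Not at h
    obtain ⟨i, hi⟩ := h
    exact rvw_perc n r σ hσ i (fun k hk => by simpa using hi k hk)

lemma rvw_upper {p : ℝ} (hp : 0 < p) (hp1 : p < 1) (n r : ℕ) (hn : n ≠ 0) :
    pW r p n ≤ p + (1 - p) * pR r p n := by
  have : NeZero n := ⟨hn⟩
  unfold pR pW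
  rw [dif_neg hn, dif_neg hn, ← rvw_pr_option hp hp1]
  apply rvw_pr_mono hp hp1
  intro σ hσ
  by_cases h : σ none = true
  · left; exact h
  · right; exact rvw_hub n r σ (by simpa using h) (hσ none)

lemma rvw_pR_mem {p : ℝ} (hp : 0 < p) (hp1 : p < 1) (n r : ℕ) :
    0 ≤ pR r p n ∧ pR r p n ≤ 1 := by
  unfold pR
  split_ifs
  · simp
  · rename_i h
    have : NeZero n := ⟨h⟩
    exact ⟨rvw_pr_nonneg hp hp1 _, rvw_pr_le_one hp hp1 _⟩

lemma rvw_pW_mem {p : ℝ} (hp : 0 < p) (hp1 : p < 1) (n r : ℕ) :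
    0 ≤ pW r p n ∧ pW r p n ≤ 1 := by
  unfold pW
  split_ifs
  · simp
  · rename_i h
    have : NeZero n := ⟨h⟩
    exact ⟨rvw_pr_nonneg hp hp1 _, rvw_pr_le_one hp hp1 _⟩

/-- liminf_n p_R(n,r,p) ≤ liminf_n p_W(n,r,p) and
limsup_n p_W(n,r,p) ≤ p + (1−p)·limsup_n p_R(n,r,p). -/
theorem ring_vs_wheel (p : ℝ) (hp : 0 < p) (hp1 : p < 1) (r : ℕ) (hr : 0 < r) :
    Filter.liminf (fun n => pR r p n) Filter.atTop ≤
        Filter.liminf (fun n => pW r p n) Filter.atTop ∧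
      Filter.limsup (fun n => pW r p n) Filter.atTop ≤
        p + (1 - p) * Filter.limsup (fun n => pR r p n) Filter.atTop := by
  have bR1 : Filter.IsBoundedUnder (· ≤ ·) Filter.atTop (fun n => pR r p n) :=
    Filter.isBoundedUnder_of ⟨1, fun n => (rvw_pR_mem hp hp1 n r).2⟩
  have bR0 : Filter.IsBoundedUnder (· ≥ ·) Filter.atTop (fun n => pR r p n) :=
    Filter.isBoundedUnder_of ⟨0, fun n => (rvw_pR_mem hp hp1 n r).1⟩
  have bW1 : Filter.IsBoundedUnder (· ≤ ·) Filter.atTop (fun n => pW r p n) :=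
    Filter.isBoundedUnder_of ⟨1, fun n => (rvw_pW_mem hp hp1 n r).2⟩
  have bW0 : Filter.IsBoundedUnder (· ≥ ·) Filter.atTop (fun n => pW r p n) :=
    Filter.isBoundedUnder_of ⟨0, fun n => (rvw_pW_mem hp hp1 n r).1⟩
  constructor
  · apply le_of_forall_lt
    intro c hc
    obtain ⟨d, hcd, hd⟩ := exists_between hc
    obtain ⟨c', hcc', hc'd⟩ := exists_between hcd
    refine lt_of_lt_of_le hcc' ?_
    have hlim : Filter.Tendsto (fun n : ℕ => (1 - p ^ r) ^ (n / r)) Filter.atTop (nhds 0) := by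
      have h0 : 0 < p ^ r := pow_pos hp r
      have h1 : p ^ r ≤ 1 := pow_le_one₀ hp.le hp1.le
      exact (tendsto_pow_atTop_nhds_zero_of_lt_one (by linarith) (by linarith)).comp
        (Nat.tendsto_div_const_atTop hr.ne')
    have e1 := Filter.eventually_lt_of_lt_liminf hd bR0
    have e2 := hlim.eventually_lt_const (sub_pos.2 hc'd)
    apply Filter.le_liminf_of_le bW1.isCoboundedUnder_ge
    filter_upwards [e1, e2, Filter.eventually_ne_atTop 0] with n h1 h2 h3
    have := rvw_lower hp hp1 n r h3
    linarith
  · have hq : 0 < 1 - p := by linarith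
    apply le_of_forall_pos_le_add
    intro ε hε
    have e1 := Filter.eventually_lt_of_limsup_lt
      (lt_add_of_pos_right (Filter.limsup (fun n => pR r p n) Filter.atTop) hε) bR1
    apply Filter.limsup_le_of_le bW0.isCoboundedUnder_le
    filter_upwards [e1, Filter.eventually_ne_atTop 0] with n h1 h3
    have := rvw_upper hp hp1 n r h3
    nlinarith [mul_lt_mul_of_pos_left h1 hq, mul_pos hp hε]
end

section
/- limsup_{r→∞} p_c^+(WH(r)) ≤ 1/4. -/
open Finset


open Finset

section Prob
set_option linter.all false
set_option linter.unusedSectionVars false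
set_option linter.unusedVariables false
open MeasureTheory ProbabilityTheory

/-- Bernoulli measure on `Bool`. -/
noncomputable def bern (p : ℝ) : Measure Bool :=
  ENNReal.ofReal p • Measure.dirac true + ENNReal.ofReal (1 - p) • Measure.dirac false

lemma bern_prob {p : ℝ} (h0 : 0 ≤ p) (h1 : p ≤ 1) : IsProbabilityMeasure (bern p) := by
  constructor
  simp only [bern, Measure.add_apply, Measure.smul_apply, measure_univ, smul_eq_mul, mul_one]
  rw [← ENNReal.ofReal_add h0 (by linarith)]
  simp

lemma bern_singleton {p : ℝ} (h0 : 0 ≤ p) (h1 : p ≤ 1) (b : Bool) :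
    (bern p) {b} = ENNReal.ofReal (if b then p else 1 - p) := by
  cases b <;> simp [bern]

/-- Product Bernoulli measure. -/
noncomputable def bmu (V : Type) [Fintype V] (p : ℝ) : Measure (V → Bool) :=
  Measure.pi (fun _ => bern p)

variable {V : Type} [Fintype V] [DecidableEq V]

lemma bmu_prob {p : ℝ} (h0 : 0 ≤ p) (h1 : p ≤ 1) : IsProbabilityMeasure (bmu V p) := by
  have := bern_prob h0 h1
  unfold bmu
  infer_instance

lemma weight_nonneg {p : ℝ} (h0 : 0 ≤ p) (h1 : p ≤ 1) (b : Bool) :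
    0 ≤ (if b then p else 1 - p) := by
  split_ifs <;> linarith

lemma pr_eq {p : ℝ} (h0 : 0 ≤ p) (h1 : p ≤ 1) (S : Set (V → Bool)) :
    pr p S = (bmu V p).real S := by
  classical
  have := bern_prob h0 h1
  have := bmu_prob (V := V) h0 h1
  have h : (bmu V p).real S = ∑ σ ∈ S.toFinset, (bmu V p).real {σ} := by
    rw [sum_measureReal_singleton]; simp
  rw [h, pr]
  have hs : ∀ σ : V → Bool, (bmu V p).real {σ} = ∏ v, (if σ v then p else 1 - p) := by
    intro σ
    rw [measureReal_def, bmu, Measure.pi_singleton, ENNReal.toReal_prod]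
    refine Finset.prod_congr rfl fun v _ => ?_
    rw [bern_singleton h0 h1, ENNReal.toReal_ofReal (weight_nonneg h0 h1 _)]
  simp_rw [hs]
  rw [Finset.sum_indicator_eq_sum_filter]
  refine Finset.sum_congr ?_ fun _ _ => rfl
  ext; simp

/-- An event which depends only on the coordinates in `S`. -/
def Dep (A : Set (V → Bool)) (S : Finset V) : Prop :=
  ∀ σ τ : V → Bool, (∀ i ∈ S, σ i = τ i) → (σ ∈ A → τ ∈ A)

lemma coord_indep {p : ℝ} (h0 : 0 ≤ p) (h1 : p ≤ 1) :
    iIndepFun (fun (v : V) (σ : V → Bool) => σ v) (bmu V p) := by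
  have := bern_prob h0 h1
  exact iIndepFun_pi (μ := fun _ : V => bern p) (X := fun _ b => b) (fun _ => aemeasurable_id)

lemma Dep.preimage {A : Set (V → Bool)} {S : Finset V} (hA : Dep A S) :
    A = (fun (σ : V → Bool) (i : S) => σ i) ⁻¹' ((fun (σ : V → Bool) (i : S) => σ i) '' A) := by
  ext σ
  constructor
  · intro h; exact ⟨σ, h, rfl⟩
  · rintro ⟨τ, hτ, he⟩
    exact hA τ σ (fun i hi => congrFun he ⟨i, hi⟩) hτ

lemma dep_indep {p : ℝ} (h0 : 0 ≤ p) (h1 : p ≤ 1) {A B : Set (V → Bool)} {S T : Finset V}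
    (hA : Dep A S) (hB : Dep B T) (hST : Disjoint S T) :
    (bmu V p).real (A ∩ B) = (bmu V p).real A * (bmu V p).real B := by
  have h := (coord_indep (V := V) h0 h1).indepFun_finset S T hST (fun i => measurable_pi_apply i)
  rw [indepFun_iff_measure_inter_preimage_eq_mul] at h
  have := h ((fun (σ : V → Bool) (i : S) => σ i) '' A) ((fun (σ : V → Bool) (i : T) => σ i) '' B)
    (Set.toFinite _).measurableSet (Set.toFinite _).measurableSet
  rw [← hA.preimage, ← hB.preimage] at this
  rw [measureReal_def, this, ENNReal.toReal_mul]; rfl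

lemma cyl_meas {p : ℝ} (h0 : 0 ≤ p) (h1 : p ≤ 1) {m : ℕ} (e : Fin m → V)
    (he : Function.Injective e) (b : Fin m → Bool) :
    (bmu V p).real {σ | ∀ i, σ (e i) = b i} = ∏ i, (if b i then p else 1 - p) := by
  have := bern_prob h0 h1
  have h := (coord_indep (V := V) h0 h1).precomp he
  have := h.measure_inter_preimage_eq_mul Finset.univ (sets := fun i => {b i})
    (fun i _ => MeasurableSet.singleton _)
  have hs : {σ : V → Bool | ∀ i, σ (e i) = b i} =
      ⋂ i ∈ (Finset.univ : Finset (Fin m)), (fun σ : V → Bool => σ (e i)) ⁻¹' {b i} := by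
    ext; simp
  rw [hs, measureReal_def]
  erw [this]
  rw [ENNReal.toReal_prod]
  refine Finset.prod_congr rfl fun i _ => ?_
  have := (measurePreserving_eval (fun _ : V => bern p) (e i)).measure_preimage
    (MeasurableSet.singleton (b i)).nullMeasurableSet
  have h2 : (bmu V p) ((fun σ : V → Bool => σ (e i)) ⁻¹' {b i}) = bern p {b i} := this
  erw [h2]
  rw [bern_singleton h0 h1, ENNReal.toReal_ofReal (weight_nonneg h0 h1 _)]

lemma cheb {p : ℝ} (h0 : 0 ≤ p) (h1 : p ≤ 1) {Y : Type} [Fintype Y] [Nonempty Y]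
    (B : Y → Set (V → Bool)) (S : Y → Finset V) (hB : ∀ y, Dep (B y) (S y)) (K : ℕ)
    (hK : ∀ y, (Finset.univ.filter (fun y' => ¬ Disjoint (S y) (S y'))).card ≤ K)
    (hq : ∀ y, (bmu V p).real (B y) ≤ 1 / 4) [∀ y, DecidablePred (· ∈ B y)] :
    (bmu V p).real {σ | Fintype.card Y ≤ 2 * (Finset.univ.filter (fun y => σ ∈ B y)).card}
      ≤ 16 * K / Fintype.card Y := by
  have := bmu_prob (V := V) h0 h1
  set μ := bmu V p with hμ
  set N : ℝ := (Fintype.card Y : ℝ) with hN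
  have hNpos : 0 < N := by rw [hN]; exact_mod_cast Fintype.card_pos
  have hm : ∀ A : Set (V → Bool), MeasurableSet A := fun A => (Set.toFinite A).measurableSet
  let X : Y → (V → Bool) → ℝ := fun y => (B y).indicator 1
  have hX : ∀ y, MemLp (X y) 2 μ := fun y => (memLp_const (1:ℝ)).indicator (hm _)
  have hEX : ∀ y, μ[X y] = μ.real (B y) := fun y => integral_indicator_one (hm _)
  have hcov : ∀ y y', cov[X y, X y'; μ] ≤ if Disjoint (S y) (S y') then 0 else 1 := by
    intro y y'
    rw [covariance_eq_sub (hX y) (hX y'), hEX, hEX]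
    have : X y * X y' = (B y ∩ B y').indicator 1 := by
      simp only [X]; rw [Set.inter_indicator_one]
    rw [this, integral_indicator_one (hm _)]
    split_ifs with hd
    · rw [hμ, dep_indep h0 h1 (hB y) (hB y') hd]; simp
    · have a1 : μ.real (B y ∩ B y') ≤ 1 := measureReal_le_one
      have a2 : 0 ≤ μ.real (B y) * μ.real (B y') := by positivity
      linarith
  have hvar : Var[∑ y, X y; μ] ≤ N * K := by
    rw [variance_sum hX]
    calc ∑ y, ∑ y', cov[X y, X y'; μ]
        ≤ ∑ y : Y, (K : ℝ) := by
          refine Finset.sum_le_sum fun y _ => ?_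
          refine (Finset.sum_le_sum fun y' _ => hcov y y').trans ?_
          rw [Finset.sum_ite]
          simp only [Finset.sum_const_zero, zero_add, Finset.sum_const, nsmul_eq_mul, mul_one]
          exact_mod_cast hK y
      _ = N * K := by simp [hN]
  have hmem : MemLp (∑ y, X y) 2 μ := memLp_finsetSum' _ (fun y _ => hX y)
  have hE : μ[∑ y, X y] ≤ N / 4 := by
    have : μ[∑ y, X y] = ∑ y, μ.real (B y) := by
      simp only [Finset.sum_apply]
      rw [integral_finsetSum _ (fun y _ => (hX y).integrable (by norm_num))]
      exact Finset.sum_congr rfl fun y _ => hEX y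
    rw [this]
    calc ∑ y, μ.real (B y) ≤ ∑ y : Y, (1/4 : ℝ) := Finset.sum_le_sum fun y _ => hq y
      _ = N / 4 := by simp [hN]; ring
  have hch := meas_ge_le_variance_div_sq hmem (c := N / 4) (by positivity)
  have hch2 : μ.real {ω | N / 4 ≤ |(∑ y, X y) ω - μ[∑ y, X y]|} ≤ Var[∑ y, X y; μ] / (N/4)^2 := by
    rw [measureReal_def]
    refine ENNReal.toReal_le_of_le_ofReal ?_ hch
    exact div_nonneg (variance_nonneg _ _) (by positivity)
  refine (measureReal_mono (s₂ := {ω | N / 4 ≤ |(∑ y, X y) ω - μ[∑ y, X y]|}) ?_ (measure_ne_top _ _)).trans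
    (hch2.trans ?_)
  · intro σ hσ
    simp only [Set.mem_setOf_eq] at hσ ⊢
    have hs : (∑ y, X y) σ = ((Finset.univ.filter (fun y => σ ∈ B y)).card : ℝ) := by
      simp only [Finset.sum_apply, X, Set.indicator_apply, Pi.one_apply]
      rw [Finset.sum_boole]
    rw [hs]
    have : N ≤ 2 * ((Finset.univ.filter (fun y => σ ∈ B y)).card : ℝ) := by
      rw [hN]; exact_mod_cast hσ
    refine le_trans ?_ (le_abs_self _)
    linarith
  · calc Var[∑ y, X y; μ] / (N/4)^2 ≤ N * K / (N/4)^2 := by gcongr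
      _ = 16 * K / N := by field_simp; ring

end Prob

section Det

lemma iter_fix {V : Type} [Fintype V] (f : (V → Bool) → (V → Bool))
    (hf : ∀ σ v, σ v = true → f σ v = true) (σ : V → Bool) :
    f (f^[Fintype.card V] σ) = f^[Fintype.card V] σ := by
  classical
  let c : (V → Bool) → ℕ := fun τ => (Finset.univ.filter (fun v => τ v = true)).card
  have key : ∀ k, f (f^[k] σ) = f^[k] σ ∨ k + 1 ≤ c (f (f^[k] σ)) := by
    intro k
    have step : ∀ τ, f τ = τ ∨ c τ < c (f τ) := by
      intro τ
      by_cases h : f τ = τ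
      · exact Or.inl h
      · right
        apply Finset.card_lt_card
        rw [Finset.ssubset_iff_of_subset]
        · obtain ⟨v, hv⟩ := Function.ne_iff.mp h
          refine ⟨v, ?_, ?_⟩
          · have := hf τ v
            cases h1 : τ v <;> cases h2 : f τ v <;> simp_all
          · have := hf τ v
            cases h1 : τ v <;> cases h2 : f τ v <;> simp_all
        · intro v hv
          simp only [Finset.mem_filter, Finset.mem_univ, true_and] at hv ⊢
          exact hf τ v hv
    induction k with
    | zero =>
      rcases step (f^[0] σ) with h | h
      · exact Or.inl h
      · right; omega
    | succ k ih =>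
      rw [Function.iterate_succ_apply']
      rcases ih with h | h
      · left; rw [h, h]
      · rcases step (f (f^[k] σ)) with h' | h'
        · exact Or.inl h'
        · right; omega
  rcases key (Fintype.card V) with h | h
  · exact h
  · exfalso
    have : c (f (f^[Fintype.card V] σ)) ≤ Fintype.card V := Finset.card_le_univ _
    omega

/-- 0/1 value of a Boolean. -/
def ind (b : Bool) : ℕ := if b then 1 else 0

lemma ind_mono {a b : Bool} (h : a = true → b = true) : ind a ≤ ind b := by
  cases a <;> cases b <;> simp_all [ind]

/-- Nucleation pattern with left end `s`. -/
structure IsNuc (r : ℕ) (A : ℕ → Bool) (s : ℕ) : Prop where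
  center : A (s + r) = true
  last : A (s + 2 * r + 1) = true
  ballot : ∀ t ≤ r, ∑ j ∈ Finset.range t, (ind (A (s + j)) + ind (A (s + r + 1 + j))) ≤ t
  total : ∑ j ∈ Finset.range r, (ind (A (s + j)) + ind (A (s + r + 1 + j))) = r

lemma spread (r : ℕ) (A G : ℕ → Bool) (hAG : ∀ q, A q = true → G q = true)
    (hcl : ∀ q, r ≤ q → r + 1 ≤ ∑ k ∈ Finset.Icc 1 r, (ind (G (q + k)) + ind (G (q - k))) →
      G q = true) (s : ℕ) (hs : IsNuc r A s) (T : ℕ)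
    (hne : ∀ q ≤ T, ∃ k ∈ Finset.Icc 1 r, A (q + k) = true) :
    ∀ t, (t ≤ r ∨ s + r + t ≤ T) → G (s + r + t) = true := by
  intro t
  induction t using Nat.strong_induction_on with
  | _ t ih =>
  intro ht
  rcases Nat.eq_zero_or_pos t with h0 | hpos
  · subst h0; exact hAG _ hs.center
  have prev : ∀ u < t, G (s + r + u) = true := fun u hu => ih u hu (by omega)
  apply hcl _ (by omega)
  rw [Finset.sum_add_distrib]
  rcases Nat.lt_or_ge r t with hrt | htr
  · -- far from the nucleus
    have hT : s + r + t ≤ T := by omega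
    have hl : ∑ k ∈ Finset.Icc 1 r, ind (G (s + r + t - k)) = r := by
      rw [Finset.sum_congr rfl (g := fun _ => 1)]
      · simp
      · intro k hk
        rw [Finset.mem_Icc] at hk
        have : s + r + t - k = s + r + (t - k) := by omega
        rw [this, prev _ (by omega)]; rfl
    obtain ⟨k, hk, hAk⟩ := hne _ hT
    have h1 : ind (G (s + r + t + k)) ≤ ∑ k ∈ Finset.Icc 1 r, ind (G (s + r + t + k)) :=
      Finset.single_le_sum (f := fun k => ind (G (s + r + t + k))) (fun _ _ => Nat.zero_le _) hk
    rw [hAG _ hAk] at h1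
    have : ind true = 1 := rfl
    omega
  · -- inside the nucleus
    have hl : t + ∑ j ∈ Finset.Ico t r, ind (A (s + j)) ≤
        ∑ k ∈ Finset.Icc 1 r, ind (G (s + r + t - k)) := by
      have hsplit : Finset.Icc 1 r = Finset.Icc 1 t ∪ Finset.Ioc t r := by
        ext k; simp only [Finset.mem_union, Finset.mem_Icc, Finset.mem_Ioc]; omega
      rw [hsplit, Finset.sum_union]
      · apply Nat.add_le_add
        · apply le_of_eq
          rw [Finset.sum_congr rfl (g := fun _ => 1)]
          · simp
          · intro k hk
            rw [Finset.mem_Icc] at hk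
            have : s + r + t - k = s + r + (t - k) := by omega
            rw [this, prev _ (by omega)]; rfl
        · have : ∑ j ∈ Finset.Ico t r, ind (A (s + j)) =
              ∑ k ∈ Finset.Ioc t r, ind (A (s + r + t - k)) := by
            refine Finset.sum_bij' (fun j _ => r + t - j) (fun k _ => r + t - k) ?_ ?_ ?_ ?_ ?_
            · intro j hj; simp only [Finset.mem_Ico, Finset.mem_Ioc] at hj ⊢; omega
            · intro j hj; simp only [Finset.mem_Ico, Finset.mem_Ioc] at hj ⊢; omega
            · intro j hj; simp only [Finset.mem_Ico, Finset.mem_Ioc] at hj ⊢; omega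
            · intro j hj; simp only [Finset.mem_Ico, Finset.mem_Ioc] at hj ⊢; omega
            · intro j hj; simp only [Finset.mem_Ico] at hj
              congr 2; omega
          rw [this]
          exact Finset.sum_le_sum fun k _ => ind_mono (hAG _)
      · rw [Finset.disjoint_left]
        intro k; simp only [Finset.mem_Icc, Finset.mem_Ioc]; omega
    have hr : 1 + ∑ j ∈ Finset.Ico t r, ind (A (s + r + 1 + j)) ≤
        ∑ k ∈ Finset.Icc 1 r, ind (G (s + r + t + k)) := by
      calc 1 + ∑ j ∈ Finset.Ico t r, ind (A (s + r + 1 + j))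
          = ∑ j ∈ Finset.Ico t (r + 1), ind (A (s + r + 1 + j)) := by
            rw [Finset.sum_Ico_succ_top htr]
            have : s + r + 1 + r = s + 2 * r + 1 := by omega
            rw [this, hs.last, Nat.add_comm]; rfl
        _ ≤ ∑ j ∈ Finset.Ico t (t + r), ind (A (s + r + 1 + j)) := by
            apply Finset.sum_le_sum_of_subset
            intro j; simp only [Finset.mem_Ico]; omega
        _ = ∑ k ∈ Finset.Icc 1 r, ind (A (s + r + t + k)) := by
            refine Finset.sum_bij' (fun j _ => j + 1 - t) (fun k _ => k + t - 1) ?_ ?_ ?_ ?_ ?_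
            · intro j hj; simp only [Finset.mem_Ico, Finset.mem_Icc] at hj ⊢; omega
            · intro j hj; simp only [Finset.mem_Ico, Finset.mem_Icc] at hj ⊢; omega
            · intro j hj; simp only [Finset.mem_Ico] at hj ⊢; omega
            · intro j hj; simp only [Finset.mem_Icc] at hj ⊢; omega
            · intro j hj; simp only [Finset.mem_Ico] at hj
              congr 2; omega
        _ ≤ _ := Finset.sum_le_sum fun k _ => ind_mono (hAG _)
    have hb := hs.ballot t htr
    have htot := hs.total
    rw [← Finset.sum_range_add_sum_Ico _ htr, Finset.sum_add_distrib (s := Finset.Ico t r)] at htot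
    omega

/-- The offsets view of a configuration. -/
def view {n : ℕ} (σ : Option (ZMod n) → Bool) (z : ZMod n) (q : ℕ) : Bool :=
  σ (some (z + (q : ZMod n)))

/-- The good event at `z`. -/
def Good (n r J : ℕ) (z : ZMod n) (σ : Option (ZMod n) → Bool) : Prop :=
  (∃ j < J, IsNuc r (view σ z) (j * (2 * r + 2))) ∧
    ∀ q ≤ J * (2 * r + 2), ∃ k ∈ Finset.Icc 1 r, view σ z (q + k) = true

lemma wheelStep_infl (n r : ℕ) [NeZero n] (σ : Option (ZMod n) → Bool) (v : Option (ZMod n))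
    (h : σ v = true) : wheelStep n r σ v = true := by
  cases v <;> simp [wheelStep, h]

lemma percolates (n r J : ℕ) [NeZero n] (σ : Option (ZMod n) → Bool)
    (S : Finset (ZMod n)) (hS : ∀ z ∈ S, Good n r J z σ) (hcard : n + 1 ≤ 2 * S.card) :
    ∀ v, wheelFix n r σ v = true := by
  set F := wheelFix n r σ with hF
  have hfix : wheelStep n r F = F := by
    have := iter_fix (wheelStep n r) (wheelStep_infl n r) σ
    rw [Fintype.card_option, ZMod.card] at this
    exact this
  have hσF : ∀ v, σ v = true → F v = true := by
    have : ∀ m v, σ v = true → (wheelStep n r)^[m] σ v = true := by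
      intro m
      induction m with
      | zero => intro v h; exact h
      | succ m ih => intro v h; rw [Function.iterate_succ_apply']; exact wheelStep_infl _ _ _ _ (ih v h)
    exact this _
  have hring : ∀ i, r + 1 ≤ wheelNbrs n r F i → F (some i) = true := by
    intro i hi
    rw [← hfix]; simp [wheelStep, hi]
  have hview : ∀ z q, r ≤ q → (if F none then 1 else 0) +
      ∑ k ∈ Finset.Icc 1 r, (ind (view F z (q + k)) + ind (view F z (q - k))) =
      wheelNbrs n r F (z + (q : ZMod n)) := by
    intro z q hq
    unfold wheelNbrs
    congr 1
    refine Finset.sum_congr rfl fun k hk => ?_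
    rw [Finset.mem_Icc] at hk
    have e1 : view F z (q + k) = F (some (z + (q : ZMod n) + (k : ZMod n))) := by
      simp only [view]; rw [Nat.cast_add, add_assoc]
    have e2 : view F z (q - k) = F (some (z + (q : ZMod n) - (k : ZMod n))) := by
      simp only [view]; rw [Nat.cast_sub (by omega : k ≤ q), add_sub_assoc]
    rw [e1, e2]; rfl
  have hspread : ∀ z ∈ S, ∃ s, s + 2 * r + 2 ≤ J * (2 * r + 2) ∧
      ∀ t, (t ≤ r ∨ s + r + t ≤ J * (2 * r + 2)) → view F z (s + r + t) = true := by
    intro z hz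
    obtain ⟨⟨j, hj, hn⟩, hne⟩ := hS z hz
    refine ⟨j * (2 * r + 2), ?_, spread r (view σ z) (view F z) (fun q h => hσF _ h) ?_ _ hn _ hne⟩
    · have : (j + 1) * (2 * r + 2) ≤ J * (2 * r + 2) := Nat.mul_le_mul_right _ hj
      rw [add_mul, one_mul] at this
      omega
    · intro q hq h
      apply hring
      rw [← hview z q hq]
      omega
  have hnone : F none = true := by
    have h2 : S.card ≤ (Finset.univ.filter (fun i : ZMod n => F (some i) = true)).card := by
      apply Finset.card_le_card_of_injOn (fun z => z + ((J * (2 * r + 2) : ℕ) : ZMod n))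
      · intro z hz
        obtain ⟨s, hs, h⟩ := hspread z hz
        have := h (J * (2 * r + 2) - s - r) (Or.inr (by omega))
        rw [show s + r + (J * (2 * r + 2) - s - r) = J * (2 * r + 2) by omega] at this
        simpa [view] using this
      · intro a _ b _ hab
        simpa using hab
    rw [← hfix]
    simp only [wheelStep, Bool.or_eq_true, decide_eq_true_eq]
    right; omega
  obtain ⟨z, hz⟩ : S.Nonempty := by
    rw [← Finset.card_pos]; omega
  obtain ⟨s, hs, h⟩ := hspread z hz
  have hall : ∀ t, view F z (s + r + t) = true := by
    intro t
    induction t using Nat.strong_induction_on with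
    | _ t ih =>
    by_cases ht : t ≤ r
    · exact h t (Or.inl ht)
    · apply hring
      rw [← hview z _ (by omega), hnone, Finset.sum_add_distrib]
      have hl : ∑ k ∈ Finset.Icc 1 r, ind (view F z (s + r + t - k)) = r := by
        rw [Finset.sum_congr rfl (g := fun _ => 1)]
        · simp
        · intro k hk
          rw [Finset.mem_Icc] at hk
          have : s + r + t - k = s + r + (t - k) := by omega
          rw [this, ih _ (by omega)]; rfl
      rw [hl]; simp only [if_true]; omega
  intro v
  cases v with
  | none => exact hnone
  | some i =>
    have := hall ((i - z - ((s + r : ℕ) : ZMod n)).val)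
    simp only [view] at this
    rw [Nat.cast_add, ZMod.natCast_zmod_val] at this
    convert this using 2
    congr 1; ring

end Det

section Dyck
open DyckStep

/-- Bits of a Dyck word followed by two active sites (`D` = active). -/
def bit (w : DyckWord) (i : ℕ) : Bool := decide ((w.toList ++ [D, D]).getD i U = D)

/-- Interleaving of the two halves of the nucleus. -/
def pos (r i : ℕ) : ℕ := i / 2 + (i % 2) * (r + 1)

lemma sum_getD (l : List DyckStep) (m : ℕ) :
    ∑ i ∈ Finset.range m, ind (decide (l.getD i U = D)) = (l.take m).count D := by
  induction m with
  | zero => simp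
  | succ m ih =>
    rw [Finset.sum_range_succ, ih, List.take_add_one, List.count_append]
    congr 1
    rw [List.getD_eq_getElem?_getD]
    rcases h : l[m]? with _ | a
    · simp [ind]
    · cases a <;> simp [ind]

lemma sum_pairs (g : ℕ → ℕ) (t : ℕ) :
    ∑ i ∈ Finset.range (2 * t), g i = ∑ j ∈ Finset.range t, (g (2 * j) + g (2 * j + 1)) := by
  induction t with
  | zero => simp
  | succ t ih =>
    rw [show 2 * (t + 1) = 2 * t + 1 + 1 by ring, Finset.sum_range_succ, Finset.sum_range_succ, ih,
      Finset.sum_range_succ]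
    ring

lemma count_UD (l : List DyckStep) : l.count U + l.count D = l.length := by
  induction l with
  | nil => simp
  | cons a l ih => cases a <;> simp <;> omega

lemma word_length {r : ℕ} (w : DyckWord) (hw : w.semilength = r) : w.toList.length = 2 * r := by
  rw [← hw, DyckWord.two_mul_semilength_eq_length]

lemma sum_bit {r : ℕ} (w : DyckWord) (hw : w.semilength = r) {t : ℕ} (ht : t ≤ r) :
    ∑ i ∈ Finset.range (2 * t), ind (bit w i) = (w.toList.take (2 * t)).count D := by
  have hl := word_length w hw
  have := sum_getD (w.toList ++ [D, D]) (2 * t)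
  rw [List.take_append_of_le_length (by omega)] at this
  exact this

lemma count_D_total {r : ℕ} (w : DyckWord) (hw : w.semilength = r) : w.toList.count D = r := by
  have h1 := count_UD w.toList
  have h2 := w.count_U_eq_count_D
  have hl := word_length w hw
  omega

lemma bit_total {r : ℕ} (w : DyckWord) (hw : w.semilength = r) :
    ∑ i ∈ Finset.range (2 * r + 2), ind (bit w i) = r + 2 := by
  have hl := word_length w hw
  have := sum_getD (w.toList ++ [D, D]) (2 * r + 2)
  rw [List.take_of_length_le (by simp [hl]), List.count_append, count_D_total w hw] at this
  exact this

lemma prod_bits (p : ℝ) (b : ℕ → Bool) (m : ℕ) :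
    ∀ c, ∑ i ∈ Finset.range m, ind (b i) = c →
    ∏ i ∈ Finset.range m, (if b i then p else 1 - p) = p ^ c * (1 - p) ^ (m - c) := by
  induction m with
  | zero => intro c hc; simp at hc; subst hc; simp
  | succ m ih =>
    intro c hc
    rw [Finset.sum_range_succ] at hc
    have hle : ∑ i ∈ Finset.range m, ind (b i) ≤ m := by
      calc _ ≤ ∑ i ∈ Finset.range m, 1 := Finset.sum_le_sum fun i _ => by
            unfold ind; split_ifs <;> omega
        _ = m := by simp
    rw [Finset.prod_range_succ, ih _ rfl]
    subst hc
    cases h : b m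
    · simp only [ind, Bool.false_eq_true, if_false, add_zero]
      simp only [ind] at hle
      rw [Nat.succ_sub hle, pow_succ]; ring
    · simp only [ind, if_true]
      rw [Nat.add_sub_add_right, pow_succ]; ring

lemma prod_bit {r : ℕ} (p : ℝ) (w : DyckWord) (hw : w.semilength = r) :
    ∏ i : Fin (2 * r + 2), (if bit w i then p else 1 - p) = p ^ (r + 2) * (1 - p) ^ r := by
  have h := prod_bits p (bit w) (2 * r + 2) _ (bit_total w hw)
  rw [Finset.prod_range] at h
  rw [h]; congr 2; omega

lemma bit_inj {r : ℕ} (w w' : DyckWord) (hw : w.semilength = r) (hw' : w'.semilength = r)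
    (h : ∀ i < 2 * r + 2, bit w i = bit w' i) : w = w' := by
  have hl := word_length w hw
  have hl' := word_length w' hw'
  ext1
  apply List.ext_getElem (by omega)
  intro i h1 h2
  have := h i (by omega)
  simp only [bit, List.getD_eq_getElem?_getD] at this
  rw [List.getElem?_append_left h1, List.getElem?_append_left h2, List.getElem?_eq_getElem h1,
    List.getElem?_eq_getElem h2] at this
  simp only [Option.getD_some, decide_eq_decide] at this
  cases ha : w.toList[i] <;> cases hb : w'.toList[i] <;> simp_all

lemma nuc_of_bits {r : ℕ} (w : DyckWord) (hw : w.semilength = r) (A : ℕ → Bool) (s : ℕ)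
    (h : ∀ i < 2 * r + 2, A (s + pos r i) = bit w i) : IsNuc r A s := by
  have hl := word_length w hw
  have e0 : ∀ j, pos r (2 * j) = j := by intro j; unfold pos; simp
  have e1 : ∀ j, pos r (2 * j + 1) = r + 1 + j := by
    intro j; unfold pos
    rw [show (2 * j + 1) / 2 = j by omega, show (2 * j + 1) % 2 = 1 by omega]; ring
  have hs : ∀ t ≤ r, ∑ j ∈ Finset.range t, (ind (A (s + j)) + ind (A (s + r + 1 + j))) =
      (w.toList.take (2 * t)).count D := by
    intro t ht
    rw [← sum_bit w hw ht, sum_pairs]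
    refine Finset.sum_congr rfl fun j hj => ?_
    rw [Finset.mem_range] at hj
    rw [← h (2 * j) (by omega), ← h (2 * j + 1) (by omega), e0, e1]
    simp only [add_assoc]
  refine ⟨?_, ?_, ?_, ?_⟩
  · have := h (2 * r) (by omega)
    rw [e0] at this
    rw [this]
    simp [bit, List.getElem?_append_right, hl]
  · have := h (2 * r + 1) (by omega)
    rw [e1] at this
    rw [show s + 2 * r + 1 = s + (r + 1 + r) by ring, this]
    simp [bit, List.getElem?_append_right, hl]
  · intro t ht
    rw [hs t ht]
    have h1 := count_UD (w.toList.take (2 * t))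
    have h2 := w.count_D_le_count_U (2 * t)
    rw [List.length_take] at h1
    omega
  · rw [hs r le_rfl, List.take_of_length_le (by omega), count_D_total w hw]

end Dyck

section Est
set_option linter.unusedSectionVars false
open MeasureTheory

variable {n : ℕ} [NeZero n]

lemma shift_inj (z : ZMod n) {a b : ℕ} (ha : a < n) (hb : b < n)
    (h : z + (a : ZMod n) = z + (b : ZMod n)) : a = b := by
  have h2 : (a : ZMod n) = (b : ZMod n) := by simpa using h
  rw [ZMod.natCast_eq_natCast_iff', Nat.mod_eq_of_lt ha, Nat.mod_eq_of_lt hb] at h2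
  exact h2

/-- Sites at offsets in `I` from `z`. -/
def sites (z : ZMod n) (I : Finset ℕ) : Finset (Option (ZMod n)) :=
  I.image (fun q : ℕ => some (z + (q : ZMod n)))

lemma sites_disjoint (z : ZMod n) {I I' : Finset ℕ} (h : Disjoint I I')
    (hI : ∀ a ∈ I, a < n) (hI' : ∀ a ∈ I', a < n) : Disjoint (sites z I) (sites z I') := by
  rw [Finset.disjoint_left] at h ⊢
  intro v hv hv'
  simp only [sites, Finset.mem_image] at hv hv'
  obtain ⟨a, ha, rfl⟩ := hv
  obtain ⟨b, hb, hab⟩ := hv'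
  have := shift_inj z (hI' b hb) (hI a ha) (Option.some.inj hab)
  subst this
  exact h ha hb

lemma view_congr {z : ZMod n} {I : Finset ℕ} {σ τ : Option (ZMod n) → Bool}
    (h : ∀ v ∈ sites z I, σ v = τ v) {q : ℕ} (hq : q ∈ I) : view σ z q = view τ z q :=
  h _ (Finset.mem_image_of_mem _ hq)

lemma isNuc_congr {r s : ℕ} {A A' : ℕ → Bool}
    (h : ∀ q, s ≤ q → q < s + (2 * r + 2) → A q = A' q) (hA : IsNuc r A s) : IsNuc r A' s := by
  have hs : ∀ t ≤ r, ∑ j ∈ Finset.range t, (ind (A (s + j)) + ind (A (s + r + 1 + j))) =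
      ∑ j ∈ Finset.range t, (ind (A' (s + j)) + ind (A' (s + r + 1 + j))) := by
    intro t ht
    refine Finset.sum_congr rfl fun j hj => ?_
    rw [Finset.mem_range] at hj
    rw [h (s + j) (by omega) (by omega), h (s + r + 1 + j) (by omega) (by omega)]
  refine ⟨?_, ?_, ?_, ?_⟩
  · rw [← h _ (by omega) (by omega)]; exact hA.center
  · rw [← h _ (by omega) (by omega)]; exact hA.last
  · intro t ht; rw [← hs t ht]; exact hA.ballot t ht
  · rw [← hs r le_rfl]; exact hA.total

/-- Lower bound for the nucleation probability. -/
noncomputable def qn (r : ℕ) (p : ℝ) : ℝ := catalan r * (p ^ (r + 2) * (1 - p) ^ r)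

lemma nuc_prob {p : ℝ} (h0 : 0 ≤ p) (h1 : p ≤ 1) (r : ℕ) (z : ZMod n) (s : ℕ)
    (hs : s + (2 * r + 2) ≤ n) :
    qn r p ≤ (bmu (Option (ZMod n)) p).real {σ | IsNuc r (view σ z) s} := by
  have := bmu_prob (V := Option (ZMod n)) h0 h1
  let e : Fin (2 * r + 2) → Option (ZMod n) := fun i => some (z + ((s + pos r i : ℕ) : ZMod n))
  have hpos : ∀ i < 2 * r + 2, pos r i < 2 * r + 2 := by
    intro i hi
    unfold pos
    rcases Nat.mod_two_eq_zero_or_one i with h | h <;> rw [h] <;> omega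
  have he : Function.Injective e := by
    intro i j hij
    have h := shift_inj z (by have := hpos i i.2; omega) (by have := hpos j j.2; omega)
      (Option.some.inj hij)
    have hi := i.2
    have hj := j.2
    ext
    unfold pos at h
    rcases Nat.mod_two_eq_zero_or_one i with h' | h' <;>
    rcases Nat.mod_two_eq_zero_or_one j with h'' | h'' <;> rw [h', h''] at h <;> omega
  let C : {w : DyckWord // w.semilength = r} → Set (Option (ZMod n) → Bool) :=
    fun w => {σ | ∀ i : Fin (2 * r + 2), σ (e i) = bit w.1 i}
  have hC : ∀ w, (bmu (Option (ZMod n)) p).real (C w) = p ^ (r + 2) * (1 - p) ^ r := by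
    intro w
    rw [← prod_bit p w.1 w.2]
    exact cyl_meas h0 h1 e he (fun i => bit w.1 i)
  have hsub : (⋃ w ∈ (Finset.univ : Finset {w : DyckWord // w.semilength = r}), C w) ⊆
      {σ | IsNuc r (view σ z) s} := by
    intro σ hσ
    simp only [Set.mem_iUnion] at hσ
    obtain ⟨w, -, hw⟩ := hσ
    exact nuc_of_bits w.1 w.2 _ _ (fun i hi => hw ⟨i, hi⟩)
  refine le_trans (le_of_eq ?_) (measureReal_mono hsub (measure_ne_top _ _))
  rw [measureReal_biUnion_finset]
  · simp only [hC]
    rw [Finset.sum_const, Finset.card_univ, DyckWord.card_dyckWord_semilength_eq_catalan,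
      nsmul_eq_mul, qn]
  · intro w _ w' _ hne
    rw [Function.onFun, Set.disjoint_left]
    intro σ hσ hσ'
    apply hne
    apply Subtype.ext
    apply bit_inj _ _ w.2 w'.2
    intro i hi
    rw [← hσ ⟨i, hi⟩, ← hσ' ⟨i, hi⟩]
  · intro w _
    exact (Set.toFinite _).measurableSet

lemma noNuc_prob {p : ℝ} (h0 : 0 ≤ p) (h1 : p ≤ 1) (r : ℕ) (z : ZMod n) (J : ℕ)
    (hJ : J * (2 * r + 2) ≤ n) :
    (bmu (Option (ZMod n)) p).real {σ | ∀ j < J, ¬ IsNuc r (view σ z) (j * (2 * r + 2))}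
      ≤ (1 - qn r p) ^ J := by
  have := bmu_prob (V := Option (ZMod n)) h0 h1
  induction J with
  | zero => simp
  | succ J ih =>
    rw [add_mul, one_mul] at hJ
    have heq : {σ : Option (ZMod n) → Bool | ∀ j < J + 1, ¬ IsNuc r (view σ z) (j * (2 * r + 2))} =
        {σ | ∀ j < J, ¬ IsNuc r (view σ z) (j * (2 * r + 2))} ∩
        {σ | IsNuc r (view σ z) (J * (2 * r + 2))}ᶜ := by
      ext σ
      simp only [Set.mem_ofPred_eq, Set.mem_inter_iff, Set.mem_compl_iff]
      constructor
      · intro h; exact ⟨fun j hj => h j (by omega), h J (by omega)⟩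
      · rintro ⟨h, h'⟩ j hj
        rcases Nat.lt_succ_iff_lt_or_eq.mp hj with hj | rfl
        · exact h j hj
        · exact h'
    have hA : Dep {σ : Option (ZMod n) → Bool | ∀ j < J, ¬ IsNuc r (view σ z) (j * (2 * r + 2))}
        (sites z (Finset.range (J * (2 * r + 2)))) := by
      intro σ τ hστ hσ j hj hn
      refine hσ j hj (isNuc_congr ?_ hn)
      intro q hq1 hq2
      have : (j + 1) * (2 * r + 2) ≤ J * (2 * r + 2) := Nat.mul_le_mul_right _ hj
      rw [add_mul, one_mul] at this
      exact (view_congr hστ (Finset.mem_range.mpr (by omega))).symm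
    have hB : Dep {σ : Option (ZMod n) → Bool | IsNuc r (view σ z) (J * (2 * r + 2))}ᶜ
        (sites z (Finset.Ico (J * (2 * r + 2)) (J * (2 * r + 2) + (2 * r + 2)))) := by
      intro σ τ hστ hσ hn
      refine hσ (isNuc_congr ?_ hn)
      intro q hq1 hq2
      exact (view_congr hστ (Finset.mem_Ico.mpr ⟨hq1, hq2⟩)).symm
    rw [heq, dep_indep h0 h1 hA hB, pow_succ]
    · have hq := nuc_prob h0 h1 r z (J * (2 * r + 2)) hJ
      have hle : (bmu (Option (ZMod n)) p).real
          {σ | IsNuc r (view σ z) (J * (2 * r + 2))}ᶜ ≤ 1 - qn r p := by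
        rw [probReal_compl_eq_one_sub (Set.toFinite _).measurableSet]
        linarith
      have h3 : (bmu (Option (ZMod n)) p).real {σ | IsNuc r (view σ z) (J * (2 * r + 2))} ≤ 1 :=
        measureReal_le_one
      exact mul_le_mul (ih (by omega)) hle measureReal_nonneg (pow_nonneg (by linarith) _)
    · apply sites_disjoint
      · rw [Finset.disjoint_left]; intro a; simp only [Finset.mem_range, Finset.mem_Ico]; omega
      · intro a; simp only [Finset.mem_range]; omega
      · intro a; simp only [Finset.mem_Ico]; omega

lemma empty_prob {p : ℝ} (h0 : 0 ≤ p) (h1 : p ≤ 1) (r : ℕ) (z : ZMod n) (q : ℕ)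
    (hq : q + r < n) :
    (bmu (Option (ZMod n)) p).real {σ | ¬ ∃ k ∈ Finset.Icc 1 r, view σ z (q + k) = true}
      = (1 - p) ^ r := by
  have h := cyl_meas h0 h1 (V := Option (ZMod n)) (m := r)
    (fun i => some (z + ((q + (i + 1) : ℕ) : ZMod n))) ?_ (fun _ => false)
  · simp only [Bool.false_eq_true, if_false, Finset.prod_const, Finset.card_univ,
      Fintype.card_fin] at h
    rw [← h]
    congr 1
    ext σ
    simp only [Set.mem_ofPred_eq, not_exists, not_and, Finset.mem_Icc, Bool.not_eq_true, view]
    constructor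
    · intro h i; exact h (i + 1) (by have := i.2; omega)
    · intro h k hk
      have := h ⟨k - 1, by omega⟩
      simp only at this
      rwa [show q + (k - 1 + 1) = q + k by omega] at this
  · intro i j hij
    have := shift_inj z (by have := i.2; omega) (by have := j.2; omega) (Option.some.inj hij)
    ext; omega

lemma bad_prob {p : ℝ} (h0 : 0 ≤ p) (h1 : p ≤ 1) (r : ℕ) (z : ZMod n) (J : ℕ)
    (hn : J * (2 * r + 2) + r < n) :
    (bmu (Option (ZMod n)) p).real {σ | ¬ Good n r J z σ} ≤
      (1 - qn r p) ^ J + (J * (2 * r + 2) + 1) * (1 - p) ^ r := by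
  have := bmu_prob (V := Option (ZMod n)) h0 h1
  have hsub : {σ : Option (ZMod n) → Bool | ¬ Good n r J z σ} ⊆
      {σ | ∀ j < J, ¬ IsNuc r (view σ z) (j * (2 * r + 2))} ∪
      ⋃ q ∈ Finset.range (J * (2 * r + 2) + 1),
        {σ | ¬ ∃ k ∈ Finset.Icc 1 r, view σ z (q + k) = true} := by
    intro σ hσ
    simp only [Set.mem_ofPred_eq, Good, not_and_or] at hσ
    rcases hσ with h | h
    · left
      intro j hj hn
      exact h ⟨j, hj, hn⟩
    · right
      push Not at h
      obtain ⟨q, hq, h⟩ := h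
      simp only [Set.mem_iUnion]
      refine ⟨q, Finset.mem_range.mpr (by omega), ?_⟩
      rintro ⟨k, hk, hv⟩
      exact h k hk hv
  refine (measureReal_mono hsub (measure_ne_top _ _)).trans ((measureReal_union_le _ _).trans ?_)
  refine add_le_add (noNuc_prob h0 h1 r z J (by omega)) ?_
  refine (measureReal_biUnion_finset_le _ _).trans ?_
  rw [Finset.sum_congr rfl (g := fun _ => (1 - p) ^ r)]
  · simp
  · intro q hq
    rw [Finset.mem_range] at hq
    exact empty_prob h0 h1 r z q (by omega)

lemma bad_dep (r J : ℕ) (z : ZMod n) :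
    Dep {σ | ¬ Good n r J z σ} (sites z (Finset.range (J * (2 * r + 2) + r + 1))) := by
  intro σ τ hστ hσ hτ
  apply hσ
  obtain ⟨⟨j, hj, hn⟩, hne⟩ := hτ
  refine ⟨⟨j, hj, isNuc_congr ?_ hn⟩, ?_⟩
  · intro q hq1 hq2
    have : (j + 1) * (2 * r + 2) ≤ J * (2 * r + 2) := Nat.mul_le_mul_right _ hj
    rw [add_mul, one_mul] at this
    exact (view_congr hστ (Finset.mem_range.mpr (by omega))).symm
  · intro q hq
    obtain ⟨k, hk, hv⟩ := hne q hq
    refine ⟨k, hk, ?_⟩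
    rw [Finset.mem_Icc] at hk
    rw [view_congr hστ (Finset.mem_range.mpr (by omega))]
    exact hv

lemma overlap_card (W : ℕ) (y : ZMod n) :
    (Finset.univ.filter (fun y' : ZMod n => ¬ Disjoint (sites y (Finset.range W))
      (sites y' (Finset.range W)))).card ≤ W ^ 2 := by
  calc _ ≤ ((Finset.range W ×ˢ Finset.range W).image
        (fun ab : ℕ × ℕ => y + (ab.1 : ZMod n) - (ab.2 : ZMod n))).card := by
        apply Finset.card_le_card
        intro y' hy'
        simp only [Finset.mem_filter, Finset.mem_univ, true_and, Finset.not_disjoint_iff,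
          sites, Finset.mem_image] at hy'
        obtain ⟨v, ⟨a, ha, rfl⟩, b, hb, hab⟩ := hy'
        rw [Finset.mem_image]
        refine ⟨(a, b), Finset.mem_product.mpr ⟨ha, hb⟩, ?_⟩
        have := Option.some.inj hab
        simp only
        rw [← this]; ring
    _ ≤ _ := Finset.card_image_le.trans (by simp [sq])

lemma perc_prob {p : ℝ} (h0 : 0 ≤ p) (h1 : p ≤ 1) (r J : ℕ)
    (hn : J * (2 * r + 2) + r < n)
    (hq : (1 - qn r p) ^ J + (J * (2 * r + 2) + 1) * (1 - p) ^ r ≤ 1 / 4) :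
    1 - 16 * ((J * (2 * r + 2) + r + 1) ^ 2 : ℕ) / n ≤
      (bmu (Option (ZMod n)) p).real {σ | ∀ v, wheelFix n r σ v = true} := by
  classical
  have := bmu_prob (V := Option (ZMod n)) h0 h1
  have hc := cheb h0 h1 (Y := ZMod n) (fun z => {σ | ¬ Good n r J z σ})
    (fun z => sites z (Finset.range (J * (2 * r + 2) + r + 1))) (bad_dep r J)
    ((J * (2 * r + 2) + r + 1) ^ 2) (overlap_card _)
    (fun z => (bad_prob h0 h1 r z J hn).trans hq)
  rw [ZMod.card] at hc
  have hsub : {σ : Option (ZMod n) → Bool | ∀ v, wheelFix n r σ v = true}ᶜ ⊆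
      {σ | n ≤ 2 * (Finset.univ.filter (fun y => σ ∈ {σ | ¬ Good n r J y σ})).card} := by
    intro σ hσ
    by_contra hcon
    apply hσ
    simp only [Set.mem_ofPred_eq, not_le] at hcon
    apply percolates n r J σ (Finset.univ.filter (fun z => Good n r J z σ))
    · intro z hz; exact (Finset.mem_filter.mp hz).2
    · have := Finset.card_filter_add_card_filter_not (s := (Finset.univ : Finset (ZMod n)))
        (fun z => Good n r J z σ)
      rw [Finset.card_univ, ZMod.card] at this
      omega
  have h2 := (measureReal_mono hsub (measure_ne_top (bmu (Option (ZMod n)) p) _)).trans hc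
  rw [probReal_compl_eq_one_sub (Set.toFinite _).measurableSet] at h2
  linarith

end Est

section Final
open MeasureTheory Filter

lemma qn_le_one {p : ℝ} (h0 : 0 ≤ p) (h1 : p ≤ 1) (r : ℕ) : qn r p ≤ 1 := by
  have : NeZero (2 * r + 2) := ⟨by omega⟩
  have := bmu_prob (V := Option (ZMod (2 * r + 2))) h0 h1
  exact (nuc_prob (n := 2 * r + 2) h0 h1 r 0 0 (by omega)).trans measureReal_le_one

lemma qn_lower {p : ℝ} (h0 : 0 < p) (h1 : p < 1) (r : ℕ) (hr : 0 < r) :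
    (1 - p) ^ r * ((4 * p) ^ r * p ^ 2) ≤ 2 * r * (r + 1) * qn r p := by
  have hc : (4 : ℝ) ^ r ≤ 2 * r * (r + 1) * catalan r := by
    have h := Nat.four_pow_le_two_mul_self_mul_centralBinom r hr
    rw [← succ_mul_catalan_eq_centralBinom] at h
    have h' : ((4 ^ r : ℕ) : ℝ) ≤ ((2 * r * ((r + 1) * catalan r) : ℕ) : ℝ) := by exact_mod_cast h
    push_cast at h'
    linarith
  have hq : 0 < 1 - p := by linarith
  calc (1 - p) ^ r * ((4 * p) ^ r * p ^ 2) = 4 ^ r * (p ^ (r + 2) * (1 - p) ^ r) := by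
        rw [mul_pow, pow_add]; ring
    _ ≤ (2 * r * (r + 1) * catalan r) * (p ^ (r + 2) * (1 - p) ^ r) := by gcongr
    _ = _ := by rw [qn]; ring

lemma exists_J {p : ℝ} (h0 : 1 / 4 < p) (h1 : p < 1) :
    ∀ᶠ r : ℕ in atTop, ∃ J : ℕ,
      (1 - qn r p) ^ J + (J * (2 * r + 2) + 1) * (1 - p) ^ r ≤ 1 / 4 := by
  have hp : 0 < p := by linarith
  have hlim := tendsto_pow_const_mul_const_pow_of_lt_one 3 (r := 1 / (4 * p)) (by positivity)
    (by rw [div_lt_one (by positivity)]; linarith)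
  have hev := hlim.eventually (gt_mem_nhds (show (0:ℝ) < p ^ 2 / 640 by positivity))
  filter_upwards [hev, eventually_ge_atTop 1] with r hr hr1
  have hr1' : (1 : ℝ) ≤ r := by exact_mod_cast hr1
  have hlow := qn_lower hp h1 r (by omega)
  have hq1 := qn_le_one hp.le h1.le r
  have h1p : 0 < 1 - p := by linarith
  set q := qn r p with hqdef
  have hq : 0 < q := by
    by_contra hcon
    have : 0 < (1 - p) ^ r * ((4 * p) ^ r * p ^ 2) := by positivity
    have : 2 * (r:ℝ) * (r + 1) * q ≤ 0 :=
      mul_nonpos_of_nonneg_of_nonpos (by positivity) (by linarith)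
    linarith
  refine ⟨⌈3 / q⌉₊, ?_⟩
  set J := ⌈3 / q⌉₊
  have hJ1 : 3 / q ≤ J := Nat.le_ceil _
  have hJ2 : (J : ℝ) < 3 / q + 1 := Nat.ceil_lt_add_one (by positivity)
  have hA : (1 - q) ^ J ≤ 1 / 8 := by
    have e1 : 1 - q ≤ Real.exp (-q) := by have := Real.add_one_le_exp (-q); linarith
    have e2 : (1 - q) ^ J ≤ Real.exp (-q) ^ J := pow_le_pow_left₀ (by linarith) e1 _
    rw [← Real.exp_nat_mul] at e2
    have e3 : (J : ℝ) * -q ≤ -3 := by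
      rw [div_le_iff₀ hq] at hJ1; linarith
    have e4 : Real.exp (-3) ≤ 1 / 8 := by
      have h2 : (2:ℝ) ≤ Real.exp 1 := by have := Real.add_one_le_exp (1:ℝ); linarith
      have h3 : (8:ℝ) ≤ Real.exp 3 := by
        calc (8:ℝ) = 2 ^ 3 := by norm_num
          _ ≤ Real.exp 1 ^ 3 := by gcongr
          _ = Real.exp 3 := by rw [← Real.exp_nat_mul]; norm_num
      rw [Real.exp_neg, ← one_div]
      exact one_div_le_one_div_of_le (by norm_num) h3
    exact e2.trans ((Real.exp_le_exp.mpr e3).trans e4)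
  have hB : (J * (2 * r + 2) + 1) * (1 - p) ^ r ≤ 1 / 8 := by
    have hJq : (J : ℝ) * q ≤ 4 := by
      have : (J : ℝ) * q < (3 / q + 1) * q := by gcongr
      rw [add_mul, div_mul_cancel₀ _ hq.ne'] at this
      linarith
    have h4p : 0 < (4 * p) ^ r := by positivity
    -- bound `(1-p)^r`
    have hx : (1 - p) ^ r ≤ 2 * r * (r + 1) * q / ((4 * p) ^ r * p ^ 2) := by
      rw [le_div_iff₀ (by positivity)]; exact hlow
    have hr' : (r:ℝ) ^ 3 < p ^ 2 / 640 * (4 * p) ^ r := by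
      rw [one_div, inv_pow, ← div_eq_mul_inv, div_lt_iff₀ h4p] at hr
      exact hr
    calc (J * (2 * r + 2) + 1) * (1 - p) ^ r
        ≤ (J * (2 * r + 2) + 1) * (2 * r * (r + 1) * q / ((4 * p) ^ r * p ^ 2)) := by gcongr
      _ = ((J * q) * (2 * r + 2) + q) * (2 * r * (r + 1)) / ((4 * p) ^ r * p ^ 2) := by ring
      _ ≤ (4 * (2 * r + 2) + 1) * (2 * r * (r + 1)) / ((4 * p) ^ r * p ^ 2) := by gcongr
      _ ≤ (80 * r ^ 3) / ((4 * p) ^ r * p ^ 2) := by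
          refine div_le_div_of_nonneg_right ?_ (by positivity)
          have a1 : (4 * (2 * (r:ℝ) + 2) + 1) ≤ 20 * r := by linarith
          have a2 : (2 * (r:ℝ) * (r + 1)) ≤ 4 * r ^ 2 := by nlinarith
          calc _ ≤ (20 * (r:ℝ)) * (4 * r ^ 2) := by gcongr
            _ = _ := by ring
      _ ≤ 1 / 8 := by
          rw [div_le_iff₀ (by positivity)]
          linarith
  linarith

lemma pW_tendsto {p : ℝ} (h0 : 0 ≤ p) (h1 : p ≤ 1) (r J : ℕ)
    (hq : (1 - qn r p) ^ J + (J * (2 * r + 2) + 1) * (1 - p) ^ r ≤ 1 / 4) :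
    Tendsto (fun n => pW r p n) atTop (nhds 1) := by
  have hlow : Tendsto (fun n : ℕ => 1 - 16 * (((J * (2 * r + 2) + r + 1) ^ 2 : ℕ) : ℝ) / n)
      atTop (nhds 1) := by
    have := (tendsto_const_div_atTop_nhds_zero_nat
      (16 * (((J * (2 * r + 2) + r + 1) ^ 2 : ℕ) : ℝ))).const_sub 1
    simpa using this
  refine tendsto_of_tendsto_of_tendsto_of_le_of_le' hlow tendsto_const_nhds ?_ ?_
  · filter_upwards [eventually_gt_atTop (J * (2 * r + 2) + r)] with n hn
    have hn0 : n ≠ 0 := by omega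
    have : NeZero n := ⟨hn0⟩
    rw [pW, dif_neg hn0, pr_eq h0 h1]
    exact perc_prob h0 h1 r J hn hq
  · filter_upwards [eventually_gt_atTop 0] with n hn
    have hn0 : n ≠ 0 := by omega
    have : NeZero n := ⟨hn0⟩
    have := bmu_prob (V := Option (ZMod n)) h0 h1
    rw [pW, dif_neg hn0, pr_eq h0 h1]
    exact measureReal_le_one

lemma pcPlus_le {p : ℝ} (h0 : 1 / 4 < p) (h1 : p < 1) : ∀ᶠ r : ℕ in atTop, pcPlus r ≤ p := by
  filter_upwards [exists_J h0 h1] with r hr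
  obtain ⟨J, hJ⟩ := hr
  exact csInf_le ⟨0, fun x hx => hx.1.1⟩
    ⟨⟨by linarith, h1.le⟩, (pW_tendsto (by linarith) h1.le r J hJ).liminf_eq⟩

lemma pcPlus_nonneg (r : ℕ) : 0 ≤ pcPlus r := Real.sInf_nonneg fun _ hx => hx.1.1

end Final

/-- `limsup_{r→∞} p_c^+(WH(r)) ≤ 1/4`. -/
theorem pcPlus_limsup_le :
    Filter.limsup (fun r : ℕ => pcPlus r) Filter.atTop ≤ (1 / 4 : ℝ) := by
  have hcb : Filter.IsCoboundedUnder (· ≤ ·) Filter.atTop (fun r : ℕ => pcPlus r) :=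
    Filter.isCoboundedUnder_le_of_le Filter.atTop (x := 0) pcPlus_nonneg
  refine le_of_forall_gt_imp_ge_of_dense fun a ha => ?_
  refine Filter.limsup_le_of_le hcb ?_
  have h := pcPlus_le (p := min a (1 / 2)) (lt_min ha (by norm_num))
    (lt_of_le_of_lt (min_le_right _ _) (by norm_num))
  filter_upwards [h] with r hr
  exact hr.trans (min_le_left _ _)
end
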